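/- arXiv:math/0703096 — 2 statements merged into one kernel-verified Lean document; each statement's English description precedes it below -/
import Mathlib

section
/- The fundamental group of the complement of the trefoil knot in S³ is not isomorphic to ℤ, the fundamental group of the complement of the unknot; hence the trefoil knot is not equivalent to the unknot. -/
/-- Two subsets of `ℝ³` are ambient isotopic if there is a continuous family of
homeomorphisms of `ℝ³`, starting at the identity, carrying the first set onto the second. -/
def AmbientIsotopic (A B : Set (Fin 3 → ℝ)) : Prop :=
  ∃ F : ℝ → (Fin 3 → ℝ) → (Fin 3 → ℝ),
    Continuous (fun p : ℝ × (Fin 3 → ℝ) => F p.1 p.2) ∧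
    (∀ t : ℝ, IsHomeomorph (F t)) ∧
    F 0 = id ∧ F 1 '' A = B

/-- A parametrization of the trefoil knot in `ℝ³`. -/
noncomputable def trefoil (t : ℝ) : Fin 3 → ℝ :=
  ![Real.sin t + 2 * Real.sin (2 * t), Real.cos t - 2 * Real.cos (2 * t), -Real.sin (3 * t)]

/-- The round unknot in `ℝ³`. -/
noncomputable def unknot (t : ℝ) : Fin 3 → ℝ := ![Real.cos t, Real.sin t, 0]

open Topology unitInterval

/-- The map sending `(a, X)` to the pair `(a, b)` for which `X` is a root of `T³ - 3 a T + 2 b`. -/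
noncomputable def cubicRootMap (q : ℂ × ℂ) : ℂ × ℂ := (q.1, (3 * q.1 * q.2 - q.2 ^ 3) / 2)

/-- The pairs `(a, b)` for which the cubic `T³ - 3 a T + 2 b` has distinct roots. -/
def squarefreeCubics : Set (ℂ × ℂ) := {p | p.1 ^ 3 ≠ p.2 ^ 2}

theorem continuous_cubicRootMap : Continuous cubicRootMap := by
  unfold cubicRootMap; fun_prop

theorem isProperMap_cubicRootMap : IsProperMap cubicRootMap := by
  rw [isProperMap_iff_isCompact_preimage]
  refine ⟨continuous_cubicRootMap, fun K hK ↦ ?_⟩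
  obtain ⟨C, hC⟩ := hK.isBounded.exists_norm_le
  refine Metric.isCompact_of_isClosed_isBounded (hK.isClosed.preimage continuous_cubicRootMap)
    ((isBounded_iff_forall_norm_le).2 ⟨5 * C + 1, fun q hq ↦ ?_⟩)
  have h := hC _ hq
  have h1 : ‖q.1‖ ≤ C := (norm_fst_le (cubicRootMap q)).trans h
  have h2 : ‖(3 * q.1 * q.2 - q.2 ^ 3) / 2‖ ≤ C := (norm_snd_le (cubicRootMap q)).trans h
  have h3 : ‖q.2‖ ^ 3 ≤ 3 * C * ‖q.2‖ + 2 * C := by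
    calc ‖q.2‖ ^ 3 = ‖3 * q.1 * q.2 - 2 * ((3 * q.1 * q.2 - q.2 ^ 3) / 2)‖ := by
          rw [← norm_pow]; congr 1; ring
      _ ≤ ‖3 * q.1 * q.2‖ + ‖2 * ((3 * q.1 * q.2 - q.2 ^ 3) / 2)‖ := norm_sub_le _ _
      _ = 3 * ‖q.1‖ * ‖q.2‖ + 2 * ‖(3 * q.1 * q.2 - q.2 ^ 3) / 2‖ := by
          simp only [norm_mul, Complex.norm_ofNat]
      _ ≤ 3 * C * ‖q.2‖ + 2 * C := by gcongr
  have h0 : 0 ≤ C := (norm_nonneg _).trans h1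
  refine norm_prod_le_iff.2 ⟨by linarith, ?_⟩
  by_contra! hlt
  have : 1 ≤ ‖q.2‖ := by linarith
  nlinarith [mul_le_mul_of_nonneg_left this h0, mul_nonneg h0 (norm_nonneg q.2), sq_nonneg ‖q.2‖,
    mul_lt_mul_of_pos_right hlt (by positivity : 0 < ‖q.2‖ ^ 2),
    mul_le_mul_of_nonneg_left this (norm_nonneg q.2)]

theorem sq_ne_of_cubicRootMap_mem {q : ℂ × ℂ} (hq : cubicRootMap q ∈ squarefreeCubics) :
    q.1 - q.2 ^ 2 ≠ 0 := by
  intro h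
  apply hq
  simp only [cubicRootMap]
  rw [sub_eq_zero.1 h]
  ring

theorem isLocalHomeomorphOn_cubicRootMap :
    IsLocalHomeomorphOn cubicRootMap (cubicRootMap ⁻¹' squarefreeCubics) := by
  refine IsLocalHomeomorphOn.mk _ _ fun q hq ↦ ?_
  have hu : 3 / 2 * (q.1 - q.2 ^ 2) ≠ 0 :=
    mul_ne_zero (by norm_num) (sq_ne_of_cubicRootMap_mem hq)
  let D : (ℂ × ℂ) ≃L[ℂ] ℂ × ℂ := (ContinuousLinearEquiv.refl ℂ ℂ).skewProd
    (ContinuousLinearEquiv.unitsEquivAut ℂ (Units.mk0 _ hu))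
    ((3 / 2 * q.2) • ContinuousLinearMap.id ℂ ℂ)
  have hD : HasStrictFDerivAt cubicRootMap (D : ℂ × ℂ →L[ℂ] ℂ × ℂ) q := by
    have h1 : HasStrictFDerivAt (fun q : ℂ × ℂ ↦ q.1) (ContinuousLinearMap.fst ℂ ℂ ℂ) q :=
      hasStrictFDerivAt_fst
    have h2 : HasStrictFDerivAt (fun q : ℂ × ℂ ↦ q.2) (ContinuousLinearMap.snd ℂ ℂ ℂ) q :=
      hasStrictFDerivAt_snd
    have h3 := h1.prodMk
      ((((h1.const_mul 3).mul h2).sub (h2.pow 3)).mul_const (1 / 2 : ℂ))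
    have hfun : cubicRootMap = fun q ↦ (q.1, (3 * q.1 * q.2 - q.2 ^ 3) * (1 / 2)) := by
      funext q; simp only [cubicRootMap]; ring_nf
    rw [hfun]
    refine h3.congr_fderiv ?_
    ext <;> simp [D] <;> ring
  exact ⟨hD.toOpenPartialHomeomorph cubicRootMap, hD.mem_toOpenPartialHomeomorph_source,
    fun _ _ ↦ rfl⟩

theorem finite_fiber_cubicRootMap (p : ℂ × ℂ) : (cubicRootMap ⁻¹' {p}).Finite := by
  let P : Polynomial ℂ := .X ^ 3 - .C (3 * p.1) * .X + .C (2 * p.2)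
  have hP : P ≠ 0 := by
    have : P.coeff 3 = 1 := by simp [P]
    intro h; simp [h] at this
  refine ((Polynomial.finite_setOfPred_isRoot hP).image (fun X ↦ (p.1, X))).subset fun q hq ↦ ?_
  obtain rfl : cubicRootMap q = p := hq
  refine ⟨q.2, ?_, rfl⟩
  simp only [Set.mem_ofPred_eq, Polynomial.IsRoot.def, P, cubicRootMap]
  simp
  ring

theorem isCoveringMap_cubicRootMap :
    IsCoveringMap (squarefreeCubics.restrictPreimage cubicRootMap) :=
  (isProperMap_cubicRootMap.isClosedMap.isCoveringMapOn_of_isLocalHomeomorphOn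
    (fun p _ ↦ finite_fiber_cubicRootMap p)
    isLocalHomeomorphOn_cubicRootMap).isCoveringMap_restrictPreimage

theorem IsCoveringMap.not_commute_of_lifts {E X Y : Type*} [TopologicalSpace E]
    [TopologicalSpace X] [TopologicalSpace Y] {p : E → X} (cov : IsCoveringMap p) (f : C(Y, X))
    {y y₀ y₁ : Y} (c₀ : Path y y₀) (c₁ : Path y y₁) (α : Path y₀ y₀) (β : Path y₁ y₁)
    (e : E) (he : p e = f y₀)
    (hα : ∀ Γ : C(I, E), (∀ t, p (Γ t) = f (α t)) → (Γ 1 = Γ 0 ↔ Γ 0 = e))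
    (hβ : ∀ Γ : C(I, E), (∀ t, p (Γ t) = f (β t)) → Γ 1 ≠ Γ 0) :
    ¬ ∀ g h : FundamentalGroup Y y, g * h = h * g := by
  intro comm
  let Q {a b : Y} (γ : Path a b) : Path.Homotopic.Quotient (f a) (f b) :=
    .mk (γ.map f.continuous)
  have Qtrans {a b c : Y} (γ : Path a b) (γ' : Path b c) (e) :
      cov.monodromy (Q (γ.trans γ')) e = cov.monodromy (Q γ') (cov.monodromy (Q γ) e) := by
    rw [← cov.monodromy_trans_apply]
    simp only [Q, ← Path.Homotopic.Quotient.mk_trans, Path.map_trans]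
  have Qsymm {a b : Y} (γ : Path a b) (e) :
      cov.monodromy (Q γ) (cov.monodromy (Q γ.symm) e) = e := by
    rw [← Qtrans]
    have : Q (γ.symm.trans γ) = .refl _ := by
      refine (Path.Homotopic.Quotient.eq.2 ?_)
      have h : (γ.symm.trans γ).Homotopic (Path.refl b) := ⟨(Path.Homotopy.reflSymmTrans γ).symm⟩
      exact h.map f
    rw [this, cov.monodromy_refl]; rfl
  have lift {a : Y} (γ : Path a a) (e : p ⁻¹' {f a}) : ∃ Γ : C(I, E),
      (∀ t, p (Γ t) = f (γ t)) ∧ Γ 0 = e ∧ Γ 1 = cov.monodromy (Q γ) e :=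
    ⟨cov.liftPath (γ.map f.continuous) e (by simpa using e.2.symm),
      fun t ↦ congrFun (cov.liftPath_lifts ..) t, cov.liftPath_zero .., rfl⟩
  have fixα (e' : p ⁻¹' {f y₀}) : cov.monodromy (Q α) e' = e' ↔ e'.1 = e := by
    obtain ⟨Γ, h, h0, h1⟩ := lift α e'
    rw [← h0, ← hα Γ h, h0, h1, Subtype.ext_iff]
  have fixβ (e' : p ⁻¹' {f y₁}) : cov.monodromy (Q β) e' ≠ e' := by
    obtain ⟨Γ, h, h0, h1⟩ := lift β e'
    rw [Ne, Subtype.ext_iff, ← h1, ← h0]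
    exact hβ Γ h
  let g := (c₀.trans α).trans c₀.symm
  let h := (c₁.trans β).trans c₁.symm
  have comm' (e : p ⁻¹' {f y}) : cov.monodromy (Q g) (cov.monodromy (Q h) e) =
      cov.monodromy (Q h) (cov.monodromy (Q g) e) := by
    rw [← Qtrans, ← Qtrans]
    have := congrArg (fun x ↦ Path.Homotopic.Quotient.map x f)
      (comm (Path.Homotopic.Quotient.mk g) (Path.Homotopic.Quotient.mk h))
    exact congrArg (fun x ↦ cov.monodromy x e) this
  let e₁ := cov.monodromy (Q c₀.symm) ⟨e, he⟩
  have h1 : cov.monodromy (Q g) e₁ = e₁ := by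
    simp only [g, e₁, Qtrans, Qsymm]
    rw [(fixα _).2 rfl]
  have h2 : cov.monodromy (Q g) (cov.monodromy (Q h) e₁) = cov.monodromy (Q h) e₁ := by
    rw [comm', h1]
  have h3 : cov.monodromy (Q c₀) (cov.monodromy (Q h) e₁) = ⟨e, he⟩ := by
    refine Subtype.ext ((fixα _).1 ?_)
    have := congrArg (cov.monodromy (Q c₀)) h2
    simpa only [g, Qtrans, Qsymm] using this
  have h4 : cov.monodromy (Q h) e₁ = e₁ := by
    refine (cov.monodromy_bijective (Q c₀)).1 ?_
    rw [h3, Qsymm]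
  refine fixβ (cov.monodromy (Q c₁) e₁) ?_
  have := congrArg (cov.monodromy (Q c₁)) h4
  simpa only [h, Qtrans, Qsymm] using this

noncomputable def trefoilPlane (v : Fin 3 → ℝ) : ℂ := ⟨v 1, -v 0⟩

noncomputable def trefoilHeight (v : Fin 3 → ℝ) : ℂ := ⟨(5 - v 0 ^ 2 - v 1 ^ 2) / 4, -v 2⟩

/-- A map `ℝ³ → ℂ²` for which the trefoil is the preimage of the discriminant locus. -/
noncomputable def trefoilCubic (v : Fin 3 → ℝ) : ℂ × ℂ :=
  (trefoilPlane v / (starRingEnd ℂ (trefoilHeight v) - 2), trefoilHeight v)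

theorem conj_trefoilHeight_sub_two_ne_zero (v : Fin 3 → ℝ) :
    starRingEnd ℂ (trefoilHeight v) - 2 ≠ 0 := by
  intro h
  have := congrArg Complex.re h
  simp [trefoilHeight] at this
  nlinarith [sq_nonneg (v 0), sq_nonneg (v 1)]

theorem continuous_trefoilCubic : Continuous trefoilCubic := by
  have h1 : Continuous trefoilPlane :=
    Complex.equivRealProdCLM.symm.continuous.comp
      (g := Complex.equivRealProdCLM.symm) (f := fun v : Fin 3 → ℝ ↦ (v 1, -v 0)) (by fun_prop)
  have h2 : Continuous trefoilHeight :=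
    Complex.equivRealProdCLM.symm.continuous.comp (g := Complex.equivRealProdCLM.symm)
      (f := fun v : Fin 3 → ℝ ↦ ((5 - v 0 ^ 2 - v 1 ^ 2) / 4, -v 2)) (by fun_prop)
  exact (h1.div ((Complex.continuous_conj.comp h2).sub continuous_const)
    conj_trefoilHeight_sub_two_ne_zero).prodMk h2

theorem normSq_trefoilPlane (v : Fin 3 → ℝ) :
    Complex.normSq (trefoilPlane v) =
      Complex.normSq (starRingEnd ℂ (trefoilHeight v) - 2) + 1 -
        Complex.normSq (trefoilHeight v) := by
  simp [trefoilPlane, trefoilHeight, Complex.normSq_apply]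
  ring

theorem normSq_trefoilHeight_trefoil (t : ℝ) :
    Complex.normSq (trefoilHeight (trefoil t)) = 1 := by
  have h : Real.cos (3 * t) = Real.cos (2 * t) * Real.cos t - Real.sin (2 * t) * Real.sin t := by
    rw [← Real.cos_add]; ring_nf
  have h1 := Real.sin_sq_add_cos_sq t
  have h2 := Real.sin_sq_add_cos_sq (2 * t)
  have h3 := Real.sin_sq_add_cos_sq (3 * t)
  have : (5 - trefoil t 0 ^ 2 - trefoil t 1 ^ 2) / 4 = Real.cos (3 * t) := by
    simp only [trefoil, Matrix.cons_val]
    rw [h]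
    linear_combination -h1 / 4 - h2
  rw [Complex.normSq_apply, trefoilHeight, this]
  simp only [trefoil, Matrix.cons_val]
  linear_combination h3

theorem mem_range_trefoil_of_trefoilCubic {v : Fin 3 → ℝ}
    (hv : trefoilCubic v ∉ squarefreeCubics) : v ∈ Set.range trefoil := by
  obtain ⟨a, ha⟩ : ∃ a, a = (trefoilCubic v).1 := ⟨_, rfl⟩
  have hd := conj_trefoilHeight_sub_two_ne_zero v
  have hw : trefoilPlane v = a * (starRingEnd ℂ (trefoilHeight v) - 2) := by
    rw [ha, trefoilCubic, div_mul_cancel₀ _ hd]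
  have hcusp : a ^ 3 = trefoilHeight v ^ 2 := by
    rw [ha]
    exact not_not.1 hv
  have hn := Complex.normSq_pos.2 hd
  have hnorm := normSq_trefoilPlane v
  have hnc := congrArg Complex.normSq hcusp
  rw [hw, map_mul] at hnorm
  rw [map_pow, map_pow] at hnc
  have hA := Complex.normSq_nonneg a
  have hm := Complex.normSq_nonneg (trefoilHeight v)
  generalize Complex.normSq (starRingEnd ℂ (trefoilHeight v) - 2) = n at hnorm hn
  have ha1 : Complex.normSq a = 1 := by
    generalize Complex.normSq a = A at *
    generalize Complex.normSq (trefoilHeight v) = m at *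
    rcases lt_trichotomy A 1 with h | h | h
    · have : A ^ 3 < 1 := pow_lt_one₀ hA h (by norm_num)
      have : 1 < m := by nlinarith
      nlinarith
    · exact h
    · have : 1 < A ^ 3 := one_lt_pow₀ h (by norm_num)
      have : m < 1 := by nlinarith
      nlinarith
  have hm1 : Complex.normSq (trefoilHeight v) = 1 := by
    rw [ha1] at hnorm; linarith
  have ha0 : a ≠ 0 := by
    rintro rfl
    simp at ha1
  have hb : ‖trefoilHeight v / a‖ = 1 := by
    rw [← sq_eq_sq₀ (norm_nonneg _) zero_le_one, ← Complex.normSq_eq_norm_sq, map_div₀, ha1, hm1]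
    norm_num
  obtain ⟨t, ht⟩ : ∃ t : ℝ, Complex.exp (t * Complex.I) = trefoilHeight v / a := by
    refine ⟨(trefoilHeight v / a).arg, ?_⟩
    conv_rhs => rw [← Complex.norm_mul_exp_arg_mul_I (trefoilHeight v / a), hb,
      Complex.ofReal_one, one_mul]
  have hz0 : trefoilHeight v ≠ 0 := by
    intro h
    simp [h] at hm1
  have h3 : trefoilHeight v = Complex.exp ((3 * t : ℝ) * Complex.I) := by
    have : Complex.exp ((3 * t : ℝ) * Complex.I) = Complex.exp (t * Complex.I) ^ 3 := by
      rw [← Complex.exp_nat_mul]; push_cast; ring_nf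
    rw [this, ht, div_pow, hcusp]
    field_simp
  have h2 : a = Complex.exp ((2 * t : ℝ) * Complex.I) := by
    have : Complex.exp ((2 * t : ℝ) * Complex.I) = Complex.exp (t * Complex.I) ^ 2 := by
      rw [← Complex.exp_nat_mul]; push_cast; ring_nf
    rw [this, ht, div_pow, ← hcusp]
    field_simp
  have h4 : trefoilPlane v =
      Complex.exp ((-t : ℝ) * Complex.I) - 2 * Complex.exp ((2 * t : ℝ) * Complex.I) := by
    rw [hw, h3, h2, ← Complex.exp_conj, mul_sub, ← Complex.exp_add]
    simp only [map_mul, Complex.conj_ofReal, Complex.conj_I]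
    push_cast
    ring_nf
  refine ⟨t, ?_⟩
  have hre := congrArg Complex.re h4
  have him := congrArg Complex.im h4
  have hh := congrArg Complex.im h3
  rw [Complex.exp_ofReal_mul_I_im] at hh
  rw [two_mul, Complex.sub_re, Complex.add_re, Complex.exp_ofReal_mul_I_re,
    Complex.exp_ofReal_mul_I_re] at hre
  rw [two_mul, Complex.sub_im, Complex.add_im, Complex.exp_ofReal_mul_I_im,
    Complex.exp_ofReal_mul_I_im] at him
  simp only [trefoilPlane, trefoilHeight, Real.cos_neg, Real.sin_neg] at hre him hh
  funext i
  fin_cases i <;> simp [trefoil] <;> linarith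

theorem eq_of_cubicRootMap_eq_const {Q : I → ℂ} (hQ : Continuous Q) {a b : ℂ}
    (h : ∀ t, cubicRootMap (a, Q t) = (a, b)) : Q 1 = Q 0 := by
  have hfin : (Set.range Q).Finite := by
    refine ((finite_fiber_cubicRootMap (a, b)).image Prod.snd).subset ?_
    rintro _ ⟨t, rfl⟩
    exact ⟨(a, Q t), h t, rfl⟩
  exact hfin.countable.isTotallyDisconnected _ subset_rfl (isPreconnected_range hQ)
    ⟨1, rfl⟩ ⟨0, rfl⟩

theorem apply_one_eq_neg_of_cube_eq {X : I → ℂ} (hX : Continuous X) (c : ℂ)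
    (h : ∀ t : I, X t ^ 3 = 3 * (c * Complex.exp (2 * Real.pi * Complex.I * (t : ℝ))) * X t) :
    X 1 = -X 0 := by
  have hQ := eq_of_cubicRootMap_eq_const (a := c) (b := 0)
    (Q := fun t ↦ X t * Complex.exp (-(Real.pi * Complex.I * (t : ℝ)))) (by fun_prop) fun t ↦ by
      have he : Complex.exp (2 * Real.pi * Complex.I * (t : ℝ)) *
          Complex.exp (-(Real.pi * Complex.I * (t : ℝ))) ^ 3 =
          Complex.exp (-(Real.pi * Complex.I * (t : ℝ))) := by
        rw [← Complex.exp_nat_mul, ← Complex.exp_add]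
        push_cast
        ring_nf
      refine Prod.ext rfl ?_
      rw [cubicRootMap, mul_pow, h t]
      linear_combination -3 / 2 * c * X t * he
  simp only [Set.Icc.coe_one, Set.Icc.coe_zero, Complex.ofReal_one, Complex.ofReal_zero, mul_one,
    mul_zero, neg_zero, Complex.exp_zero, Complex.exp_neg, Complex.exp_pi_mul_I] at hQ
  rw [← hQ]
  norm_num

theorem one_sub_mem_slitPlane {z : ℂ} (hz : ‖z‖ < 1) : 1 - z ∈ Complex.slitPlane := by
  refine Complex.mem_slitPlane_iff.2 (Or.inl ?_)
  have := (Complex.abs_re_le_norm z).trans_lt hz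
  rw [Complex.sub_re, Complex.one_re]
  linarith [(abs_lt.1 this).2]

theorem apply_one_ne_of_cubic_eq {X a : I → ℂ} (hX : Continuous X) (ha : Continuous a)
    (ha4 : ∀ t, ‖a t‖ ≤ 1 / 4)
    (hz : ∀ t : I, 5 / 4 ≤
      ‖5 / 4 - 32 + 32 * Complex.exp (2 * Real.pi * Complex.I * (t : ℝ))‖)
    (h : ∀ t : I, (3 * a t * X t - X t ^ 3) / 2 =
      5 / 4 - 32 + 32 * Complex.exp (2 * Real.pi * Complex.I * (t : ℝ)))
    (ha01 : a 1 = a 0) : X 1 ≠ X 0 := by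
  intro hX01
  have hX1 (t : I) : 1 < ‖X t‖ := by
    by_contra! hle
    have h1 := hz t
    rw [← h, norm_div] at h1
    have h2 := norm_sub_le (3 * a t * X t) (X t ^ 3)
    rw [norm_mul, norm_mul, norm_pow] at h2
    have h3 : ‖X t‖ ^ 3 ≤ 1 := pow_le_one₀ (norm_nonneg _) hle
    have h4 : ‖a t‖ * ‖X t‖ ≤ 1 / 4 * 1 :=
      mul_le_mul (ha4 t) hle (norm_nonneg _) (by norm_num)
    norm_num at h1 h2
    linarith
  have hX0 (t : I) : X t ≠ 0 := norm_pos_iff.1 (zero_lt_one.trans (hX1 t))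
  have hD (t : I) : 1 - 3 * a t / X t ^ 2 ∈ Complex.slitPlane := by
    apply one_sub_mem_slitPlane
    rw [norm_div, norm_mul, norm_pow, div_lt_one (by have := hX1 t; positivity)]
    have := one_lt_pow₀ (hX1 t) (two_ne_zero)
    have := ha4 t
    norm_num
    linarith
  have hN (t : I) : 1 - 123 / 128 * Complex.exp (-(2 * Real.pi * Complex.I * (t : ℝ))) ∈
      Complex.slitPlane := by
    apply one_sub_mem_slitPlane
    have : -(2 * Real.pi * Complex.I * (t : ℝ)) = ((-(2 * Real.pi * t) : ℝ) : ℂ) * Complex.I := by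
      push_cast; ring
    rw [norm_mul, this, Complex.norm_exp_ofReal_mul_I]
    norm_num
  let Q : I → ℂ := fun t ↦ X t * Complex.exp (-(2 * Real.pi * Complex.I * (t : ℝ) / 3)) *
    ((1 - 3 * a t / X t ^ 2) ^ ((3 : ℕ)⁻¹ : ℂ) /
      (1 - 123 / 128 * Complex.exp (-(2 * Real.pi * Complex.I * (t : ℝ)))) ^ ((3 : ℕ)⁻¹ : ℂ))
  have hr {z : ℂ} (h : z ∈ Complex.slitPlane) : z ^ ((3 : ℕ)⁻¹ : ℂ) ≠ 0 := by
    rw [Complex.cpow_ne_zero_iff]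
    exact Or.inl (Complex.slitPlane_ne_zero h)
  have hQc : Continuous Q := by
    refine .mul (by fun_prop) (.div ?_ ?_ fun t ↦ hr (hN t))
    · refine .cpow (continuous_const.sub ?_) continuous_const hD
      exact .div (by fun_prop) (by fun_prop) fun t ↦ pow_ne_zero _ (hX0 t)
    · exact .cpow (by fun_prop) continuous_const hN
  have hQ := eq_of_cubicRootMap_eq_const (a := 0) (b := 32) hQc fun t ↦ by
    refine Prod.ext rfl ?_
    have hN0 := Complex.slitPlane_ne_zero (hN t)
    have he : Complex.exp (-(2 * Real.pi * Complex.I * (t : ℝ) / 3)) ^ 3 =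
        Complex.exp (-(2 * Real.pi * Complex.I * (t : ℝ))) := by
      rw [← Complex.exp_nat_mul]
      push_cast
      ring_nf
    have he' : Complex.exp (2 * Real.pi * Complex.I * (t : ℝ)) *
        Complex.exp (-(2 * Real.pi * Complex.I * (t : ℝ))) = 1 := by
      rw [← Complex.exp_add, add_neg_cancel, Complex.exp_zero]
    have hQ3 : Q t ^ 3 = -64 := by
      simp only [Q]
      rw [mul_pow, mul_pow, div_pow, Complex.cpow_nat_inv_pow _ three_ne_zero,
        Complex.cpow_nat_inv_pow _ three_ne_zero, he, mul_div_assoc', div_eq_iff hN0]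
      have h1 : X t ^ 3 * (1 - 3 * a t / X t ^ 2) = X t ^ 3 - 3 * a t * X t := by
        field_simp [hX0 t]
      linear_combination Complex.exp (-(2 * Real.pi * Complex.I * (t : ℝ))) * (h1 - 2 * h t)
        - 64 * he'
    rw [cubicRootMap, hQ3]
    norm_num
  have hQ0 : Q 0 ≠ 0 :=
    mul_ne_zero (mul_ne_zero (hX0 0) (Complex.exp_ne_zero _)) (div_ne_zero (hr (hD 0)) (hr (hN 0)))
  have hper : Complex.exp (-(2 * Real.pi * Complex.I)) = 1 := by
    rw [Complex.exp_neg, Complex.exp_two_pi_mul_I, inv_one]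
  have hQ1 : Q 1 = Complex.exp (-(2 * Real.pi * Complex.I / 3)) * Q 0 := by
    simp only [Q, hX01, ha01, Set.Icc.coe_one, Set.Icc.coe_zero, Complex.ofReal_one,
      Complex.ofReal_zero, mul_one, mul_zero, neg_zero, zero_div, Complex.exp_zero, hper]
    ring
  rw [hQ] at hQ1
  have h1 : Complex.exp (-(2 * Real.pi * Complex.I / 3)) = 1 :=
    mul_right_cancel₀ hQ0 (by rw [← hQ1, one_mul])
  obtain ⟨n, hn⟩ := Complex.exp_eq_one_iff.1 h1
  have hpi : (Real.pi : ℂ) * Complex.I ≠ 0 :=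
    mul_ne_zero (Complex.ofReal_ne_zero.2 Real.pi_ne_zero) Complex.I_ne_zero
  have h3 : (3 * n + 1 : ℂ) = 0 := by
    refine mul_right_cancel₀ (mul_ne_zero two_ne_zero hpi) ?_
    linear_combination -3 * hn
  have h4 : 3 * n + 1 = 0 := by exact_mod_cast h3
  omega

/-- A loop around the axis of the torus carrying the trefoil, at height zero. -/
noncomputable def trefoilLongitude (t : ℝ) : Fin 3 → ℝ :=
  ![-(√5 * Real.sin (2 * Real.pi * t)), √5 * Real.cos (2 * Real.pi * t), 0]

/-- A loop linking the core of the torus carrying the trefoil. -/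
noncomputable def trefoilAxisLoop (t : ℝ) : Fin 3 → ℝ :=
  ![0, 16 * Real.sin (Real.pi * t), -(32 * Real.sin (2 * Real.pi * t))]

theorem notMem_range_trefoil {v : Fin 3 → ℝ} (hv : Complex.normSq (trefoilHeight v) ≠ 1) :
    v ∉ Set.range trefoil := by
  rintro ⟨t, rfl⟩
  exact hv (normSq_trefoilHeight_trefoil t)

theorem trefoilCubic_trefoilLongitude (t : ℝ) :
    trefoilCubic (trefoilLongitude t) =
      (-(√5 / 2 : ℝ) * Complex.exp (2 * Real.pi * Complex.I * t), 0) := by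
  have h0 : trefoilHeight (trefoilLongitude t) = 0 := by
    have h1 := Real.sin_sq_add_cos_sq (2 * Real.pi * t)
    have h5 : √5 ^ 2 = 5 := Real.sq_sqrt (by norm_num)
    apply Complex.ext
    · simp only [trefoilHeight, trefoilLongitude, Matrix.cons_val, Complex.zero_re]
      linear_combination -5 / 4 * h1 - (Real.sin (2 * Real.pi * t) ^ 2 +
        Real.cos (2 * Real.pi * t) ^ 2) / 4 * h5
    · simp [trefoilHeight, trefoilLongitude]
  have he : 2 * Real.pi * Complex.I * t = ((2 * Real.pi * t : ℝ) : ℂ) * Complex.I := by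
    push_cast; ring
  have hw : trefoilPlane (trefoilLongitude t) =
      (√5 : ℝ) * Complex.exp (2 * Real.pi * Complex.I * t) := by
    rw [he]
    apply Complex.ext
    · simp only [trefoilPlane, trefoilLongitude, Matrix.cons_val, Complex.re_ofReal_mul,
        Complex.exp_ofReal_mul_I_re]
    · simp only [trefoilPlane, trefoilLongitude, Matrix.cons_val, Complex.im_ofReal_mul,
        Complex.exp_ofReal_mul_I_im, neg_neg]
  rw [trefoilCubic, h0, hw, map_zero, zero_sub]
  refine Prod.ext ?_ rfl
  push_cast
  ring

theorem trefoilHeight_trefoilAxisLoop (t : ℝ) :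
    trefoilHeight (trefoilAxisLoop t) =
      5 / 4 - 32 + 32 * Complex.exp (2 * Real.pi * Complex.I * t) := by
  have he : 2 * Real.pi * Complex.I * t = ((2 * Real.pi * t : ℝ) : ℂ) * Complex.I := by
    push_cast; ring
  have e1 : (5 / 4 - 32 : ℂ) = ((5 / 4 - 32 : ℝ) : ℂ) := by push_cast; rfl
  have e2 : (32 : ℂ) = ((32 : ℝ) : ℂ) := by push_cast; rfl
  rw [he, e1, e2]
  apply Complex.ext
  · have h2 : Real.cos (2 * Real.pi * t) = 1 - 2 * Real.sin (Real.pi * t) ^ 2 := by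
      rw [mul_assoc, Real.cos_two_mul, Real.cos_sq']
      ring
    rw [Complex.add_re, Complex.re_ofReal_mul, Complex.exp_ofReal_mul_I_re, h2, Complex.ofReal_re]
    simp only [trefoilHeight, trefoilAxisLoop, Matrix.cons_val]
    ring
  · rw [Complex.add_im, Complex.im_ofReal_mul, Complex.exp_ofReal_mul_I_im, Complex.ofReal_im]
    simp only [trefoilHeight, trefoilAxisLoop, Matrix.cons_val]
    ring

theorem normSq_trefoilHeight_trefoilAxisLoop (t : ℝ) :
    25 / 16 ≤ Complex.normSq (trefoilHeight (trefoilAxisLoop t)) := by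
  have hs : Real.sin (2 * Real.pi * t) ^ 2 =
      4 * Real.sin (Real.pi * t) ^ 2 * (1 - Real.sin (Real.pi * t) ^ 2) := by
    rw [mul_assoc, Real.sin_two_mul, mul_pow, mul_pow, Real.cos_sq']
    norm_num
  simp only [Complex.normSq_apply, trefoilHeight, trefoilAxisLoop, Matrix.cons_val]
  nlinarith [sq_nonneg (Real.sin (Real.pi * t))]

theorem norm_trefoilCubic_trefoilAxisLoop_fst_le (t : ℝ) :
    ‖(trefoilCubic (trefoilAxisLoop t)).1‖ ≤ 1 / 4 := by
  have hs : Real.sin (2 * Real.pi * t) ^ 2 =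
      4 * Real.sin (Real.pi * t) ^ 2 * (1 - Real.sin (Real.pi * t) ^ 2) := by
    rw [mul_assoc, Real.sin_two_mul, mul_pow, mul_pow, Real.cos_sq']
    norm_num
  rw [trefoilCubic, norm_div, div_le_iff₀ (norm_pos_iff.2 (conj_trefoilHeight_sub_two_ne_zero _)),
    ← sq_le_sq₀ (norm_nonneg _) (by positivity), mul_pow, ← Complex.normSq_eq_norm_sq,
    ← Complex.normSq_eq_norm_sq]
  simp only [Complex.normSq_apply, trefoilPlane, trefoilHeight, trefoilAxisLoop, Matrix.cons_val,
    Complex.sub_re, Complex.sub_im, Complex.conj_re,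
    Complex.conj_im, Complex.re_ofNat, Complex.im_ofNat]
  nlinarith [sq_nonneg (Real.sin (Real.pi * t))]

theorem contDiff_trefoil : ContDiff ℝ 1 trefoil := by
  rw [contDiff_pi]
  intro i
  fin_cases i <;> simp only [trefoil, Fin.zero_eta, Fin.mk_one, Fin.reduceFinMk, Matrix.cons_val] <;>
    fun_prop

theorem exists_segment_subset_compl_range_trefoil {x : Fin 3 → ℝ}
    (hx : x ∈ (Set.range trefoil)ᶜ) :
    ∃ y : Fin 3 → ℝ, 1 < y 2 ∧ segment ℝ x y ⊆ (Set.range trefoil)ᶜ := by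
  let g : ℝ × ℝ → Fin 3 → ℝ := fun q ↦ x + q.1 • (trefoil q.2 - x)
  have hg : ContDiff ℝ 1 g :=
    contDiff_const.add (contDiff_fst.smul ((contDiff_trefoil.comp contDiff_snd).sub contDiff_const))
  have hd : Dense (Set.range g)ᶜ := hg.dense_compl_range_of_finrank_lt_finrank (by simp)
  obtain ⟨y, hy, hyg⟩ := hd.inter_open_nonempty {v : Fin 3 → ℝ | 1 < v 2}
    (isOpen_lt continuous_const (continuous_apply 2)) ⟨fun _ ↦ 2, by norm_num⟩
  refine ⟨y, hy, ?_⟩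
  rw [segment_eq_image']
  rintro _ ⟨r, -, rfl⟩ ⟨t, ht⟩
  obtain rfl | hr := eq_or_ne r 0
  · exact hx ⟨t, by simpa using ht⟩
  · refine hyg ⟨(r⁻¹, t), ?_⟩
    simp [g, ht, smul_smul, inv_mul_cancel₀ hr]

theorem isPathConnected_compl_range_trefoil : IsPathConnected (Set.range trefoil)ᶜ := by
  have hc : Convex ℝ {v : Fin 3 → ℝ | 1 < v 2} :=
    convex_halfSpace_gt (LinearMap.isLinear (LinearMap.proj 2)) 1
  have hs : {v : Fin 3 → ℝ | 1 < v 2} ⊆ (Set.range trefoil)ᶜ := by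
    rintro _ h ⟨t, rfl⟩
    simp only [Set.mem_ofPred_eq, trefoil, Matrix.cons_val] at h
    linarith [Real.neg_one_le_sin (3 * t)]
  have h2 : (fun _ ↦ 2 : Fin 3 → ℝ) ∈ {v : Fin 3 → ℝ | 1 < v 2} := by norm_num
  refine ⟨_, hs h2, fun {x} hx ↦ ?_⟩
  obtain ⟨y, hy, hxy⟩ := exists_segment_subset_compl_range_trefoil hx
  exact (((hc.isPathConnected ⟨_, h2⟩).joinedIn _ h2 y hy).mono hs).trans
    (JoinedIn.of_segment_subset hxy).symm

/-- The fundamental group of the trefoil complement is not abelian. -/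
theorem not_commute_of_homeomorph_compl_trefoil {Y : Type*} [TopologicalSpace Y]
    (H : ((Set.range trefoil)ᶜ : Set (Fin 3 → ℝ)) ≃ₜ Y) (y : Y) :
    ¬ ∀ g h : FundamentalGroup Y y, g * h = h * g := by
  have : PathConnectedSpace ((Set.range trefoil)ᶜ : Set (Fin 3 → ℝ)) :=
    isPathConnected_iff_pathConnectedSpace.1 isPathConnected_compl_range_trefoil
  have : PathConnectedSpace Y := H.surjective.pathConnectedSpace H.continuous
  let f : C(Y, squarefreeCubics) :=
    ⟨fun z ↦ ⟨trefoilCubic (H.symm z), fun h ↦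
      (H.symm z).2 (mem_range_trefoil_of_trefoilCubic (not_not.2 h))⟩,
      (continuous_trefoilCubic.comp (continuous_subtype_val.comp H.symm.continuous)).subtype_mk _⟩
  have hα0 (t : ℝ) : trefoilLongitude t ∈ (Set.range trefoil)ᶜ := by
    refine notMem_range_trefoil ?_
    rw [show trefoilHeight (trefoilLongitude t) = 0 from
      congrArg Prod.snd (trefoilCubic_trefoilLongitude t)]
    simp
  have hβ0 (t : ℝ) : trefoilAxisLoop t ∈ (Set.range trefoil)ᶜ := by
    refine notMem_range_trefoil ?_
    have := normSq_trefoilHeight_trefoilAxisLoop t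
    intro h
    norm_num [h] at this
  have hαc : Continuous trefoilLongitude := by
    refine continuous_pi fun i ↦ ?_
    fin_cases i <;> simp only [trefoilLongitude, Fin.zero_eta, Fin.mk_one, Fin.reduceFinMk,
      Matrix.cons_val] <;> fun_prop
  have hβc : Continuous trefoilAxisLoop := by
    refine continuous_pi fun i ↦ ?_
    fin_cases i <;> simp only [trefoilAxisLoop, Fin.zero_eta, Fin.mk_one, Fin.reduceFinMk,
      Matrix.cons_val] <;> fun_prop
  have hα1 : trefoilLongitude 1 = trefoilLongitude 0 := by simp [trefoilLongitude]
  have hβ1 : trefoilAxisLoop 1 = trefoilAxisLoop 0 := by simp [trefoilAxisLoop]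
  let α : Path (H ⟨_, hα0 0⟩) (H ⟨_, hα0 0⟩) :=
    { toFun := fun t : I ↦ H ⟨_, hα0 t⟩
      continuous_toFun := H.continuous.comp ((hαc.comp continuous_subtype_val).subtype_mk _)
      source' := rfl
      target' := by simp only [Set.Icc.coe_one, hα1] }
  let β : Path (H ⟨_, hβ0 0⟩) (H ⟨_, hβ0 0⟩) :=
    { toFun := fun t : I ↦ H ⟨_, hβ0 t⟩
      continuous_toFun := H.continuous.comp ((hβc.comp continuous_subtype_val).subtype_mk _)
      source' := rfl
      target' := by simp only [Set.Icc.coe_one, hβ1] }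
  have hfα (t : I) : (f (α t) : ℂ × ℂ) =
      (-(√5 / 2 : ℝ) * Complex.exp (2 * Real.pi * Complex.I * (t : ℝ)), 0) := by
    rw [← trefoilCubic_trefoilLongitude]
    exact congrArg (fun z ↦ trefoilCubic (Subtype.val z)) (H.symm_apply_apply ⟨_, hα0 t⟩)
  have hfβ (t : I) : (f (β t) : ℂ × ℂ) = trefoilCubic (trefoilAxisLoop t) :=
    congrArg (fun z ↦ trefoilCubic (Subtype.val z)) (H.symm_apply_apply ⟨_, hβ0 t⟩)
  have hf0 : (f (H ⟨_, hα0 0⟩) : ℂ × ℂ) = ((-(√5 / 2 : ℝ) : ℂ), 0) := by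
    have := hfα 0
    rw [α.source] at this
    simpa using this
  have he : cubicRootMap ((-(√5 / 2 : ℝ) : ℂ), 0) = f (H ⟨_, hα0 0⟩) := by
    rw [hf0]
    simp [cubicRootMap]
  have hE : ((-(√5 / 2 : ℝ) : ℂ), (0 : ℂ)) ∈ cubicRootMap ⁻¹' squarefreeCubics := by
    rw [Set.mem_preimage, he]
    exact (f _).2
  refine isCoveringMap_cubicRootMap.not_commute_of_lifts f (PathConnectedSpace.somePath _ _)
    (PathConnectedSpace.somePath _ _) α β ⟨_, hE⟩ (Subtype.ext he) ?_ ?_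
  · intro Γ hΓ
    have hΓ' (t : I) : cubicRootMap (Γ t) =
        (-(√5 / 2 : ℝ) * Complex.exp (2 * Real.pi * Complex.I * (t : ℝ)), 0) := by
      rw [← hfα, ← hΓ]; rfl
    have h1 (t : I) : (Γ t).1.1 =
        -(√5 / 2 : ℝ) * Complex.exp (2 * Real.pi * Complex.I * (t : ℝ)) :=
      congrArg Prod.fst (hΓ' t)
    have h2 (t : I) : (3 * (Γ t).1.1 * (Γ t).1.2 - (Γ t).1.2 ^ 3) / 2 = 0 :=
      congrArg Prod.snd (hΓ' t)
    have h3 : (Γ 1).1.2 = -(Γ 0).1.2 :=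
      apply_one_eq_neg_of_cube_eq (X := fun t ↦ (Γ t).1.2) (by fun_prop) (-(√5 / 2 : ℝ)) fun t ↦ by
        rw [← h1]
        linear_combination -2 * h2 t
    have h4 : (Γ 1).1.1 = (Γ 0).1.1 := by simp [h1]
    have h5 : (Γ 0).1.1 = -(√5 / 2 : ℝ) := by simp [h1]
    rw [Subtype.ext_iff, Subtype.ext_iff, Prod.ext_iff, Prod.ext_iff, h4, h3, h5]
    simp [CharZero.neg_eq_self_iff]
  · intro Γ hΓ
    have hΓ' (t : I) : cubicRootMap (Γ t) = trefoilCubic (trefoilAxisLoop t) := by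
      rw [← hfβ, ← hΓ]; rfl
    have h1 (t : I) : (Γ t).1.1 = (trefoilCubic (trefoilAxisLoop t)).1 := by
      rw [← hΓ' t]; rfl
    refine fun h ↦ apply_one_ne_of_cubic_eq (X := fun t ↦ (Γ t).1.2) (a := fun t ↦ (Γ t).1.1)
      (by fun_prop) (by fun_prop) (fun t ↦ ?_) (fun t ↦ ?_) (fun t ↦ ?_) ?_ ?_
    · rw [h1]
      exact norm_trefoilCubic_trefoilAxisLoop_fst_le t
    · rw [← trefoilHeight_trefoilAxisLoop, ← sq_le_sq₀ (by norm_num) (norm_nonneg _),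
        ← Complex.normSq_eq_norm_sq]
      exact le_trans (by norm_num) (normSq_trefoilHeight_trefoilAxisLoop t)
    · rw [← trefoilHeight_trefoilAxisLoop]
      exact congrArg Prod.snd (hΓ' t)
    · rw [h]
    · rw [h]

theorem Path.Homotopic.Quotient.trans_mem_of_open_cover {X : Type*} [TopologicalSpace X]
    {U V : Set X} (hU : IsOpen U) (hV : IsOpen V) (hUV : U ∪ V = Set.univ) {o : X}
    {T : ∀ p : X, Set (Path.Homotopic.Quotient p o)}
    (hT : ∀ (p q : X) (γ : Path p q), Set.range γ ⊆ U ∨ Set.range γ ⊆ V →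
      ∀ e ∈ T q, (Path.Homotopic.Quotient.mk γ).trans e ∈ T p)
    {p q : X} (γ : Path p q) {e : Path.Homotopic.Quotient q o} (he : e ∈ T q) :
    (Path.Homotopic.Quotient.mk γ).trans e ∈ T p := by
  obtain ⟨t, ht0, hmono, ⟨n, hn⟩, ht⟩ := exists_monotone_Icc_subset_open_cover_unitInterval
    (c := fun b : Bool ↦ γ ⁻¹' (bif b then U else V))
    (by rintro (_ | _); exacts [hV.preimage γ.continuous, hU.preimage γ.continuous])
    (fun s _ ↦ by
      rcases hUV.symm ▸ Set.mem_univ (γ s) with h | h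
      exacts [Set.mem_iUnion.2 ⟨true, h⟩, Set.mem_iUnion.2 ⟨false, h⟩])
  have key (m : ℕ) : ∀ e ∈ T (γ (t m)),
      (Path.Homotopic.Quotient.mk (γ.subpath (t 0) (t m))).trans e ∈ T (γ (t 0)) := by
    induction m with
    | zero =>
      intro e he
      rw [Path.subpath_self, ← Path.Homotopic.Quotient.refl, Path.Homotopic.Quotient.refl_trans]
      exact he
    | succ m ih =>
      intro e he
      rw [← Path.Homotopic.Quotient.eq.2 ⟨Path.Homotopy.subpathTransSubpath γ (t 0) (t m) _⟩,
        Path.Homotopic.Quotient.mk_trans, Path.Homotopic.Quotient.trans_assoc]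
      refine ih _ (hT _ _ _ ?_ e he)
      rw [Path.range_subpath_of_le _ _ _ (hmono m.le_succ), Set.image_subset_iff,
        Set.image_subset_iff]
      obtain ⟨_ | _, h⟩ := ht m
      exacts [Or.inr h, Or.inl h]
  have cast {p' q' : X} (hp : p' = p) (hq : q' = q)
      (h : ∀ e ∈ T q', (Path.Homotopic.Quotient.mk (γ.cast hp hq)).trans e ∈ T p') :
      (Path.Homotopic.Quotient.mk γ).trans e ∈ T p := by
    subst hp hq
    exact h e he
  have := key n
  rw [ht0, hn n le_rfl, Path.subpath_zero_one] at this
  exact cast _ _ this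

open CategoryTheory in
/-- If a space is the union of two open sets in which paths are determined up to homotopy by
their endpoints, and whose intersection has at most two path components, then its fundamental
group is cyclic. -/
theorem FundamentalGroup.isCyclic_of_open_cover {X : Type*} [TopologicalSpace X]
    {U V W₁ W₂ : Set X} (hU : IsOpen U) (hV : IsOpen V) (hUV : U ∪ V = Set.univ)
    (hUp : IsPathConnected U) (hVp : IsPathConnected V)
    (hUh : ∀ (p q : X) (γ γ' : Path p q), Set.range γ ⊆ U → Set.range γ' ⊆ U → γ.Homotopic γ')
    (hVh : ∀ (p q : X) (γ γ' : Path p q), Set.range γ ⊆ V → Set.range γ' ⊆ V → γ.Homotopic γ')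
    (hW : U ∩ V = W₁ ∪ W₂) (hW₁ : IsPathConnected W₁) (hW₂ : IsPathConnected W₂)
    {o : X} (ho : o ∈ W₁) : IsCyclic (FundamentalGroup X o) := by
  have path {S : Set X} (hS : IsPathConnected S) {p q : X} (hp : p ∈ S) (hq : q ∈ S) :
      ∃ γ : Path p q, Set.range γ ⊆ S := by
    obtain ⟨γ, h⟩ := hS.joinedIn p hp q hq
    exact ⟨γ, Set.range_subset_iff.2 h⟩
  let cl {p q : X} (γ : Path p q) : FundamentalGroupoid.mk p ⟶ FundamentalGroupoid.mk q :=
    Path.Homotopic.Quotient.mk γ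
  have clt {p q r : X} (γ : Path p q) (γ' : Path q r) : cl (γ.trans γ') = cl γ ≫ cl γ' := rfl
  have hU' {p q : X} (γ γ' : Path p q) (h : Set.range γ ⊆ U) (h' : Set.range γ' ⊆ U) :
      cl γ = cl γ' := Path.Homotopic.Quotient.eq.2 (hUh _ _ _ _ h h')
  have hV' {p q : X} (γ γ' : Path p q) (h : Set.range γ ⊆ V) (h' : Set.range γ' ⊆ V) :
      cl γ = cl γ' := Path.Homotopic.Quotient.eq.2 (hVh _ _ _ _ h h')
  have h₁ : W₁ ⊆ U ∩ V := hW ▸ Set.subset_union_left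
  have h₂ : W₂ ⊆ U ∩ V := hW ▸ Set.subset_union_right
  obtain ⟨w, hw⟩ := hW₂.nonempty
  obtain ⟨a, ha⟩ := path hUp (h₂ hw).1 (h₁ ho).1
  obtain ⟨b, hb⟩ := path hVp (h₂ hw).2 (h₁ ho).2
  let c : FundamentalGroup X o := inv (cl a) ≫ cl b
  have exch {p : X} {α β : Path p o} (hα : Set.range α ⊆ U) (hβ : Set.range β ⊆ V) :
      ∃ n : ℤ, cl β = cl α ≫ (c ^ n : FundamentalGroup X o) := by
    have hp : p ∈ U ∩ V := ⟨hα ⟨0, α.source⟩, hβ ⟨0, β.source⟩⟩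
    rcases hW ▸ hp with hp | hp
    · obtain ⟨δ, hδ⟩ := path hW₁ hp ho
      refine ⟨0, ?_⟩
      rw [zpow_zero, End.one_def, Category.comp_id,
        hU' α δ hα (hδ.trans (h₁.trans Set.inter_subset_left)),
        hV' β δ hβ (hδ.trans (h₁.trans Set.inter_subset_right))]
    · obtain ⟨δ, hδ⟩ := path hW₂ hp hw
      refine ⟨1, ?_⟩
      rw [zpow_one, hU' α (δ.trans a) hα, hV' β (δ.trans b) hβ, clt, clt]
      · simp [c]
      · rw [Path.trans_range]
        exact Set.union_subset (hδ.trans (h₂.trans Set.inter_subset_right)) hb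
      · rw [Path.trans_range]
        exact Set.union_subset (hδ.trans (h₂.trans Set.inter_subset_left)) ha
  let T (p : X) : Set (FundamentalGroupoid.mk p ⟶ FundamentalGroupoid.mk o) :=
    {e | ∃ (α : Path p o) (n : ℤ), (Set.range α ⊆ U ∨ Set.range α ⊆ V) ∧
      e = cl α ≫ (c ^ n : FundamentalGroup X o)}
  have czpow (m n : ℤ) : (c ^ m : FundamentalGroup X o) ≫ (c ^ n : FundamentalGroup X o) =
      (c ^ (n + m) : FundamentalGroup X o) := by
    rw [zpow_add]; rfl
  have hT (p q : X) (γ : Path p q) (hγ : Set.range γ ⊆ U ∨ Set.range γ ⊆ V) :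
      ∀ e ∈ T q, cl γ ≫ e ∈ T p := by
    rintro _ ⟨α, n, hα, rfl⟩
    suffices ∃ (α' : Path q o) (m : ℤ), cl α = cl α' ≫ (c ^ m : FundamentalGroup X o) ∧
        (Set.range γ ∪ Set.range α' ⊆ U ∨ Set.range γ ∪ Set.range α' ⊆ V) by
      obtain ⟨α', m, h, h'⟩ := this
      refine ⟨γ.trans α', n + m, ?_, ?_⟩
      · rwa [Path.trans_range]
      · rw [h, clt, Category.assoc, Category.assoc, czpow]
    have same : cl α = cl α ≫ (c ^ (0 : ℤ) : FundamentalGroup X o) := by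
      rw [zpow_zero, End.one_def, Category.comp_id]
    have hq : q ∈ Set.range γ := ⟨1, γ.target⟩
    rcases hγ with hγ | hγ <;> rcases hα with hα | hα
    · exact ⟨α, 0, same, Or.inl (Set.union_subset hγ hα)⟩
    · obtain ⟨α', hα'⟩ := path hUp (hγ hq) (h₁ ho).1
      obtain ⟨n, hn⟩ := exch hα' hα
      exact ⟨α', n, hn, Or.inl (Set.union_subset hγ hα')⟩
    · obtain ⟨α', hα'⟩ := path hVp (hγ hq) (h₁ ho).2
      obtain ⟨n, hn⟩ := exch hα hα'
      refine ⟨α', -n, ?_, Or.inr (Set.union_subset hγ hα')⟩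
      rw [hn, Category.assoc, czpow, neg_add_cancel]
      exact same
    · exact ⟨α, 0, same, Or.inr (Set.union_subset hγ hα)⟩
  refine ⟨c, fun g ↦ ?_⟩
  have hcr : Set.range (Path.refl o) ⊆ U ∩ V := by
    rw [Path.refl_range, Set.singleton_subset_iff]
    exact h₁ ho
  obtain ⟨γ, hγ⟩ := Path.Homotopic.Quotient.mk_surjective g
  have hrefl : cl (Path.refl o) = 𝟙 _ := rfl
  obtain ⟨α, n, hα, h⟩ := Path.Homotopic.Quotient.trans_mem_of_open_cover hU hV hUV
    (T := T) hT γ (e := 𝟙 (FundamentalGroupoid.mk o))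
    ⟨Path.refl o, 0, Or.inl (hcr.trans Set.inter_subset_left), by
      rw [zpow_zero, End.one_def, hrefl, Category.comp_id]⟩
  have hα1 : cl α = 𝟙 _ := by
    rcases hα with hα | hα
    · exact hU' _ _ hα (hcr.trans Set.inter_subset_left)
    · exact hV' _ _ hα (hcr.trans Set.inter_subset_right)
  refine ⟨n, ?_⟩
  rw [hα1, Category.id_comp, hγ] at h
  exact h.symm.trans (Category.comp_id (X := FundamentalGroupoid.mk o) g)

theorem StarConvex.homotopic_of_range_subset {E : Type*} [AddCommGroup E] [Module ℝ E]
    [TopologicalSpace E] [ContinuousAdd E] [ContinuousSMul ℝ E] {s S : Set E} {x : E}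
    (hs : StarConvex ℝ x s) (hne : s.Nonempty) (hsS : s ⊆ S) {p q : S} (γ γ' : Path p q)
    (hγ : Set.range γ ⊆ Subtype.val ⁻¹' s) (hγ' : Set.range γ' ⊆ Subtype.val ⁻¹' s) :
    γ.Homotopic γ' := by
  have := hs.contractibleSpace hne
  have hp : p.1 ∈ s := hγ ⟨0, γ.source⟩
  have hq : q.1 ∈ s := hγ ⟨1, γ.target⟩
  let lift (δ : Path p q) (hδ : Set.range δ ⊆ Subtype.val ⁻¹' s) : Path (⟨p, hp⟩ : s) ⟨q, hq⟩ :=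
    { toFun := fun t ↦ ⟨δ t, hδ ⟨t, rfl⟩⟩
      continuous_toFun := (continuous_subtype_val.comp δ.continuous).subtype_mk _
      source' := by simp
      target' := by simp }
  exact (SimplyConnectedSpace.paths_homotopic (lift γ hγ) (lift γ' hγ')).map
    ⟨Set.inclusion hsS, continuous_inclusion hsS⟩

noncomputable def horizontalPart (v : Fin 3 → ℝ) : ℂ := v 0 + v 1 * Complex.I

theorem continuous_horizontalPart : Continuous horizontalPart := by
  unfold horizontalPart
  fun_prop

theorem norm_horizontalPart_smul {s : ℝ} (hs : 0 ≤ s) (v : Fin 3 → ℝ) :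
    ‖horizontalPart (s • v)‖ = s * ‖horizontalPart v‖ := by
  have : horizontalPart (s • v) = s * horizontalPart v := by
    simp [horizontalPart]
    ring
  rw [this, norm_mul, Complex.norm_real, Real.norm_of_nonneg hs]

theorem horizontalPart_mk (r φ z : ℝ) :
    horizontalPart ![r * Real.cos φ, r * Real.sin φ, z] = r * Complex.exp (φ * Complex.I) := by
  rw [Complex.exp_mul_I]
  simp [horizontalPart]
  ring

theorem exists_eq_cylindrical (v : Fin 3 → ℝ) : ∃ φ : ℝ,
    v = ![‖horizontalPart v‖ * Real.cos φ, ‖horizontalPart v‖ * Real.sin φ, v 2] := by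
  refine ⟨(horizontalPart v).arg, ?_⟩
  rw [Complex.norm_mul_cos_arg, Complex.norm_mul_sin_arg]
  funext i
  fin_cases i <;> simp [horizontalPart]

theorem mem_range_unknot_iff {v : Fin 3 → ℝ} :
    v ∈ Set.range unknot ↔ v 2 = 0 ∧ ‖horizontalPart v‖ = 1 := by
  constructor
  · rintro ⟨t, rfl⟩
    refine ⟨rfl, ?_⟩
    have := horizontalPart_mk 1 t 0
    rw [one_mul, one_mul] at this
    rw [unknot, this, Complex.ofReal_one, one_mul, Complex.norm_exp_ofReal_mul_I]
  · rintro ⟨h2, h1⟩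
    obtain ⟨φ, h⟩ := exists_eq_cylindrical v
    rw [h1, h2, one_mul, one_mul] at h
    exact ⟨φ, h.symm⟩

/-- The complement of the part of the cone over the unknot with apex `(0, 0, ε)` lying on or beyond
the unknot, for `ε = ±1`. -/
def coneCompl (ε : ℝ) : Set (Fin 3 → ℝ) := {v | ε * v 2 ≤ 0 → ‖horizontalPart v‖ ≠ 1 - ε * v 2}

theorem isOpen_coneCompl (ε : ℝ) : IsOpen (coneCompl ε) := by
  have h : coneCompl ε = {v | 0 < ε * v 2} ∪ {v | ‖horizontalPart v‖ ≠ 1 - ε * v 2} := by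
    ext v
    simp only [coneCompl, Set.mem_ofPred_eq, Set.mem_union, imp_iff_not_or, not_le]
  have := continuous_horizontalPart
  rw [h]
  exact (isOpen_lt (by fun_prop) (by fun_prop)).union (isOpen_ne_fun (by fun_prop) (by fun_prop))

theorem starConvex_coneCompl {ε : ℝ} (hε : ε * ε = 1) :
    StarConvex ℝ ![0, 0, ε] (coneCompl ε) := by
  intro v hv a b ha hb hab h0 h1
  have e1 : horizontalPart (a • ![0, 0, ε] + b • v) = horizontalPart (b • v) := by
    simp [horizontalPart]
  have e2 : ε * (a • ![0, 0, ε] + b • v) 2 = a + b * (ε * v 2) := by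
    simp only [Pi.add_apply, Pi.smul_apply, smul_eq_mul, Matrix.cons_val]
    linear_combination a * hε
  rw [e2] at h0 h1
  rw [e1, norm_horizontalPart_smul hb] at h1
  have hb0 : 0 < b := by
    rcases hb.eq_or_lt with rfl | h
    · linarith
    · exact h
  refine hv ?_ ?_
  · by_contra! h
    have := mul_pos hb0 h
    linarith
  · refine mul_left_cancel₀ hb0.ne' ?_
    linarith

theorem compl_range_unknot_eq :
    (Set.range unknot)ᶜ = coneCompl 1 ∪ coneCompl (-1) := by
  ext v
  simp only [Set.mem_compl_iff, mem_range_unknot_iff, coneCompl, Set.mem_union, Set.mem_ofPred_eq]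
  constructor
  · intro h
    by_contra! h'
    exact h ⟨by linarith, by linarith⟩
  · rintro h ⟨h2, h1⟩
    simp [h2, h1] at h

theorem coneCompl_inter_eq : coneCompl 1 ∩ coneCompl (-1) =
    {v | ‖horizontalPart v‖ < 1 + |v 2|} ∪ {v | 1 + |v 2| < ‖horizontalPart v‖} := by
  ext v
  simp only [coneCompl, Set.mem_inter_iff, Set.mem_union, Set.mem_ofPred_eq, lt_or_lt_iff_ne]
  rcases le_total (v 2) 0 with h | h
  · rw [abs_of_nonpos h]
    refine ⟨fun h' h1 ↦ h'.1 (by linarith) (by linarith), fun h' ↦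
      ⟨fun _ h1 ↦ h' (by linarith), fun h0 h1 ↦ h' (by linarith)⟩⟩
  · rw [abs_of_nonneg h]
    refine ⟨fun h' h1 ↦ h'.2 (by linarith) (by linarith), fun h' ↦
      ⟨fun h0 h1 ↦ h' (by linarith), fun _ h1 ↦ h' (by linarith)⟩⟩

theorem isPathConnected_norm_horizontalPart_lt :
    IsPathConnected {v : Fin 3 → ℝ | ‖horizontalPart v‖ < 1 + |v 2|} := by
  refine StarConvex.isPathConnected (a := 0) ?_ (by simp [horizontalPart])
  intro v hv a b ha hb hab
  simp only [Set.mem_ofPred_eq] at hv ⊢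
  rw [smul_zero, zero_add, norm_horizontalPart_smul hb, Pi.smul_apply, smul_eq_mul, abs_mul,
    abs_of_nonneg hb]
  rcases hb.eq_or_lt with rfl | h
  · simp
  · nlinarith

theorem isPathConnected_lt_norm_horizontalPart :
    IsPathConnected {v : Fin 3 → ℝ | 1 + |v 2| < ‖horizontalPart v‖} := by
  let S : Set (ℝ × ℝ × ℝ) := {q | 1 + |q.2.2| < q.2.1}
  have hS : Convex ℝ S := by
    intro p hp q hq a b ha hb hab
    simp only [S, Set.mem_ofPred_eq, Prod.snd_add, Prod.fst_add, Prod.smul_snd, Prod.smul_fst,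
      smul_eq_mul] at hp hq ⊢
    have h1 : |a * p.2.2 + b * q.2.2| ≤ a * |p.2.2| + b * |q.2.2| := by
      refine (abs_add_le _ _).trans_eq ?_
      rw [abs_mul, abs_mul, abs_of_nonneg ha, abs_of_nonneg hb]
    rcases ha.eq_or_lt with rfl | h
    · obtain rfl : b = 1 := by linarith
      linarith
    · nlinarith
  have himg : {v : Fin 3 → ℝ | 1 + |v 2| < ‖horizontalPart v‖} =
      (fun q : ℝ × ℝ × ℝ ↦ ![q.2.1 * Real.cos q.1, q.2.1 * Real.sin q.1, q.2.2]) '' S := by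
    ext v
    constructor
    · intro hv
      obtain ⟨φ, h⟩ := exists_eq_cylindrical v
      exact ⟨(φ, ‖horizontalPart v‖, v 2), hv, h.symm⟩
    · rintro ⟨⟨φ, r, z⟩, h, rfl⟩
      simp only [S, Set.mem_ofPred_eq] at h
      rw [Set.mem_ofPred_eq, horizontalPart_mk, norm_mul, Complex.norm_exp_ofReal_mul_I, mul_one,
        Complex.norm_real]
      exact h.trans_le (le_abs_self r)
  rw [himg]
  refine (hS.isPathConnected ⟨(0, 2, 0), by norm_num [S]⟩).image ?_
  refine continuous_pi fun i ↦ ?_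
  fin_cases i <;> simp only [Fin.zero_eta, Fin.mk_one, Fin.reduceFinMk, Matrix.cons_val] <;>
    fun_prop

theorem isCyclic_fundamentalGroup_compl_unknot :
    ∃ x : ((Set.range unknot)ᶜ : Set (Fin 3 → ℝ)),
      IsCyclic (FundamentalGroup ((Set.range unknot)ᶜ : Set (Fin 3 → ℝ)) x) := by
  have hN : coneCompl 1 ⊆ (Set.range unknot)ᶜ :=
    compl_range_unknot_eq ▸ Set.subset_union_left
  have hS : coneCompl (-1) ⊆ (Set.range unknot)ᶜ :=
    compl_range_unknot_eq ▸ Set.subset_union_right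
  have h0N : (0 : Fin 3 → ℝ) ∈ coneCompl 1 := by simp [coneCompl, horizontalPart]
  have h0S : (0 : Fin 3 → ℝ) ∈ coneCompl (-1) := by simp [coneCompl, horizontalPart]
  have hsN := starConvex_coneCompl (ε := 1) (by norm_num)
  have hsS := starConvex_coneCompl (ε := -1) (by norm_num)
  have hin : {v | ‖horizontalPart v‖ < 1 + |v 2|} ⊆ coneCompl 1 ∩ coneCompl (-1) :=
    coneCompl_inter_eq ▸ Set.subset_union_left
  have hout : {v | 1 + |v 2| < ‖horizontalPart v‖} ⊆ coneCompl 1 ∩ coneCompl (-1) :=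
    coneCompl_inter_eq ▸ Set.subset_union_right
  refine ⟨⟨0, hN h0N⟩, FundamentalGroup.isCyclic_of_open_cover
    ((isOpen_coneCompl 1).preimage continuous_subtype_val)
    ((isOpen_coneCompl (-1)).preimage continuous_subtype_val) ?_
    ((hsN.isPathConnected (by simp [coneCompl])).preimage_coe hN)
    ((hsS.isPathConnected (by simp [coneCompl])).preimage_coe hS)
    (fun _ _ ↦ hsN.homotopic_of_range_subset ⟨0, h0N⟩ hN)
    (fun _ _ ↦ hsS.homotopic_of_range_subset ⟨0, h0S⟩ hS)
    (W₁ := Subtype.val ⁻¹' {v | ‖horizontalPart v‖ < 1 + |v 2|})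
    (W₂ := Subtype.val ⁻¹' {v | 1 + |v 2| < ‖horizontalPart v‖}) ?_
    (isPathConnected_norm_horizontalPart_lt.preimage_coe
      (hin.trans (Set.inter_subset_left.trans hN)))
    (isPathConnected_lt_norm_horizontalPart.preimage_coe
      (hout.trans (Set.inter_subset_left.trans hN))) ?_⟩
  · rw [← Set.preimage_union, ← compl_range_unknot_eq, Subtype.coe_preimage_self]
  · rw [← Set.preimage_inter, ← Set.preimage_union, coneCompl_inter_eq]
  · simp [horizontalPart]

/-- Tietze (1908): the fundamental group of the complement of the trefoil knot is not
isomorphic to `ℤ`, the fundamental group of the complement of the unknot; hence the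
trefoil knot is not equivalent to the unknot. -/
theorem trefoilGroup_not_isomorphic_int :
    (∀ x : ((Set.range trefoil)ᶜ : Set (Fin 3 → ℝ)),
      IsEmpty (FundamentalGroup ((Set.range trefoil)ᶜ : Set (Fin 3 → ℝ)) x ≃*
        Multiplicative ℤ)) ∧
    ¬ AmbientIsotopic (Set.range trefoil) (Set.range unknot) := by
  refine ⟨fun x ↦ ⟨fun e ↦ ?_⟩, ?_⟩
  · refine not_commute_of_homeomorph_compl_trefoil (Homeomorph.refl _) x fun g h ↦ ?_
    apply e.injective
    rw [map_mul, map_mul, mul_comm]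
  · rintro ⟨F, -, hF, -, hK⟩
    obtain ⟨x, hx⟩ := isCyclic_fundamentalGroup_compl_unknot
    refine not_commute_of_homeomorph_compl_trefoil (((hF 1).homeomorph).subtype fun v ↦ ?_) x
      fun g h ↦ IsCyclic.commGroup.mul_comm g h
    rw [← hK, Set.mem_compl_iff, Set.mem_compl_iff]
    exact not_congr ((hF 1).injective.mem_set_image).symm
end

section
/- The lens spaces L(7,1) and L(7,2) have isomorphic fundamental groups (both ℤ/7ℤ) but are not homeomorphic. -/
/-- The unit sphere `S³ ⊆ ℂ²`. -/
abbrev SphereC2 := (Metric.sphere (0 : EuclideanSpace ℂ (Fin 2)) 1 : Set (EuclideanSpace ℂ (Fin 2)))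

/-- A primitive 7-th root of unity. -/
noncomputable def zeta7 : ℂ := Complex.exp (2 * Real.pi * Complex.I / 7)

/-- The orbit relation of the `ℤ/7` action `(z₁, z₂) ↦ (ζ z₁, ζ^q z₂)` on `S³ ⊆ ℂ²`. -/
def lensRel7 (q : ℕ) (x y : SphereC2) : Prop :=
  ∃ k : Fin 7,
    (y : EuclideanSpace ℂ (Fin 2)) 0 = zeta7 ^ (k : ℕ) * (x : EuclideanSpace ℂ (Fin 2)) 0 ∧
    (y : EuclideanSpace ℂ (Fin 2)) 1 = zeta7 ^ (q * (k : ℕ)) * (x : EuclideanSpace ℂ (Fin 2)) 1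

/-- The lens space `L(7,q)`, the quotient of `S³ ⊆ ℂ²` by the `ℤ/7` action
`(z₁, z₂) ↦ (ζ z₁, ζ^q z₂)`. -/
def LensSpace7 (q : ℕ) := Quot (lensRel7 q)

noncomputable instance (q : ℕ) : TopologicalSpace (LensSpace7 q) := by
  unfold LensSpace7; infer_instance

section GridDegree

open Finset

/-- A grid function with values in angles, in four integer coordinates. -/
abbrev AngleGrid := ℕ → ℕ → ℕ → ℕ → Real.Angle

namespace AngleGrid

variable (θ η : AngleGrid) (i j k l : ℕ)

/-- Principal difference along the edge in direction `0`. -/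
noncomputable def d0 : ℝ := (θ (i + 1) j k l - θ i j k l).toReal
/-- Principal difference along the edge in direction `1`. -/
noncomputable def d1 : ℝ := (θ i (j + 1) k l - θ i j k l).toReal
/-- Principal difference along the edge in direction `2`. -/
noncomputable def d2 : ℝ := (θ i j (k + 1) l - θ i j k l).toReal
/-- Principal difference along the edge in direction `3`. -/
noncomputable def d3 : ℝ := (θ i j k (l + 1) - θ i j k l).toReal

/-- Total turning around the `01` plaquette; similarly for the other pairs below. -/
noncomputable def w01 : ℝ := d0 θ i j k l + d1 θ (i + 1) j k l - d0 θ i (j + 1) k l - d1 θ i j k l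
noncomputable def w02 : ℝ := d0 θ i j k l + d2 θ (i + 1) j k l - d0 θ i j (k + 1) l - d2 θ i j k l
noncomputable def w03 : ℝ := d0 θ i j k l + d3 θ (i + 1) j k l - d0 θ i j k (l + 1) - d3 θ i j k l
noncomputable def w12 : ℝ := d1 θ i j k l + d2 θ i (j + 1) k l - d1 θ i j (k + 1) l - d2 θ i j k l
noncomputable def w13 : ℝ := d1 θ i j k l + d3 θ i (j + 1) k l - d1 θ i j k (l + 1) - d3 θ i j k l
noncomputable def w23 : ℝ := d2 θ i j k l + d3 θ i j (k + 1) l - d2 θ i j k (l + 1) - d3 θ i j k l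

/-- The cup product of the edge differences of `θ` with the plaquette turnings of `η`, on the
cube spanned by the directions `0`, `1`, `2`; similarly for the other triples below. -/
noncomputable def c012 : ℝ := d0 θ i j k l * w12 η (i + 1) j k l - d1 θ i j k l * w02 η i (j + 1) k l
  + d2 θ i j k l * w01 η i j (k + 1) l
noncomputable def c013 : ℝ := d0 θ i j k l * w13 η (i + 1) j k l - d1 θ i j k l * w03 η i (j + 1) k l
  + d3 θ i j k l * w01 η i j k (l + 1)
noncomputable def c023 : ℝ := d0 θ i j k l * w23 η (i + 1) j k l - d2 θ i j k l * w03 η i j (k + 1) l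
  + d3 θ i j k l * w02 η i j k (l + 1)
noncomputable def c123 : ℝ := d1 θ i j k l * w23 η i (j + 1) k l - d2 θ i j k l * w13 η i j (k + 1) l
  + d3 θ i j k l * w12 η i j k (l + 1)

/-- The cup product of the plaquette turnings on a four-dimensional cube. -/
noncomputable def cup : ℝ :=
  w01 θ i j k l * w23 η (i + 1) (j + 1) k l - w02 θ i j k l * w13 η (i + 1) j (k + 1) l
  + w03 θ i j k l * w12 η (i + 1) j k (l + 1) + w12 θ i j k l * w03 η i (j + 1) (k + 1) l
  - w13 θ i j k l * w02 η i (j + 1) k (l + 1) + w23 θ i j k l * w01 η i j (k + 1) (l + 1)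

theorem cup_eq : cup θ η i j k l =
    (c123 θ η (i + 1) j k l - c123 θ η i j k l) - (c023 θ η i (j + 1) k l - c023 θ η i j k l)
    + (c013 θ η i j (k + 1) l - c013 θ η i j k l) - (c012 θ η i j k (l + 1) - c012 θ η i j k l) := by
  simp only [cup, c123, c023, c013, c012, w01, w02, w03, w12, w13, w23]
  ring

theorem sum_cup (P R K N : ℕ) : ∑ i ∈ range P, ∑ j ∈ range R, ∑ k ∈ range K, ∑ l ∈ range N,
    cup θ η i j k l =
    ∑ j ∈ range R, ∑ k ∈ range K, ∑ l ∈ range N, (c123 θ η P j k l - c123 θ η 0 j k l)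
    - ∑ i ∈ range P, ∑ k ∈ range K, ∑ l ∈ range N, (c023 θ η i R k l - c023 θ η i 0 k l)
    + ∑ i ∈ range P, ∑ j ∈ range R, ∑ l ∈ range N, (c013 θ η i j K l - c013 θ η i j 0 l)
    - ∑ i ∈ range P, ∑ j ∈ range R, ∑ k ∈ range K, (c012 θ η i j k N - c012 θ η i j k 0) := by
  simp only [cup_eq, sum_sub_distrib, sum_add_distrib]
  have h0 : ∀ f : ℕ → ℕ → ℕ → ℕ → ℝ, ∑ i ∈ range P, ∑ j ∈ range R, ∑ k ∈ range K, ∑ l ∈ range N,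
      f (i + 1) j k l - ∑ i ∈ range P, ∑ j ∈ range R, ∑ k ∈ range K, ∑ l ∈ range N, f i j k l =
      ∑ j ∈ range R, ∑ k ∈ range K, ∑ l ∈ range N, f P j k l -
      ∑ j ∈ range R, ∑ k ∈ range K, ∑ l ∈ range N, f 0 j k l := fun f => by
    rw [← sum_sub_distrib,
      sum_range_sub (fun i => ∑ j ∈ range R, ∑ k ∈ range K, ∑ l ∈ range N, f i j k l)]
  have h1 : ∀ f : ℕ → ℕ → ℕ → ℕ → ℝ, ∑ i ∈ range P, ∑ j ∈ range R, ∑ k ∈ range K, ∑ l ∈ range N,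
      f i (j + 1) k l - ∑ i ∈ range P, ∑ j ∈ range R, ∑ k ∈ range K, ∑ l ∈ range N, f i j k l =
      ∑ i ∈ range P, ∑ k ∈ range K, ∑ l ∈ range N, f i R k l -
      ∑ i ∈ range P, ∑ k ∈ range K, ∑ l ∈ range N, f i 0 k l := fun f => by
    simp only [← sum_sub_distrib]
    refine sum_congr rfl fun i _ => ?_
    simp only [sum_sub_distrib]
    rw [← sum_sub_distrib, sum_range_sub (fun j => ∑ k ∈ range K, ∑ l ∈ range N, f i j k l)]
  have h2 : ∀ f : ℕ → ℕ → ℕ → ℕ → ℝ, ∑ i ∈ range P, ∑ j ∈ range R, ∑ k ∈ range K, ∑ l ∈ range N,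
      f i j (k + 1) l - ∑ i ∈ range P, ∑ j ∈ range R, ∑ k ∈ range K, ∑ l ∈ range N, f i j k l =
      ∑ i ∈ range P, ∑ j ∈ range R, ∑ l ∈ range N, f i j K l -
      ∑ i ∈ range P, ∑ j ∈ range R, ∑ l ∈ range N, f i j 0 l := fun f => by
    simp only [← sum_sub_distrib]
    refine sum_congr rfl fun i _ => sum_congr rfl fun j _ => ?_
    simp only [sum_sub_distrib]
    rw [← sum_sub_distrib, sum_range_sub (fun k => ∑ l ∈ range N, f i j k l)]
  have h3 : ∀ f : ℕ → ℕ → ℕ → ℕ → ℝ, ∑ i ∈ range P, ∑ j ∈ range R, ∑ k ∈ range K, ∑ l ∈ range N,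
      f i j k (l + 1) - ∑ i ∈ range P, ∑ j ∈ range R, ∑ k ∈ range K, ∑ l ∈ range N, f i j k l =
      ∑ i ∈ range P, ∑ j ∈ range R, ∑ k ∈ range K, f i j k N -
      ∑ i ∈ range P, ∑ j ∈ range R, ∑ k ∈ range K, f i j k 0 := fun f => by
    simp only [← sum_sub_distrib]
    refine sum_congr rfl fun i _ => sum_congr rfl fun j _ => sum_congr rfl fun k _ => ?_
    rw [sum_range_sub (fun l => f i j k l)]
  rw [h0, h1, h2, h3]

/-- The turning around a plaquette is a multiple of `2π`. -/
theorem exists_toReal_sub (a b : Real.Angle) :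
    ∃ n : ℤ, (b - a).toReal = b.toReal - a.toReal + n * (2 * Real.pi) := by
  have : ((b - a).toReal : Real.Angle) = ((b.toReal - a.toReal : ℝ) : Real.Angle) := by
    simp [Real.Angle.coe_toReal]
  obtain ⟨n, hn⟩ := Real.Angle.angle_eq_iff_two_pi_dvd_sub.1 this
  exact ⟨n, by linarith⟩

theorem exists_turning (a b c d : Real.Angle) : ∃ n : ℤ,
    (b - a).toReal + (c - b).toReal - (c - d).toReal - (d - a).toReal = n * (2 * Real.pi) := by
  obtain ⟨p, hp⟩ := exists_toReal_sub a b
  obtain ⟨q, hq⟩ := exists_toReal_sub b c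
  obtain ⟨r, hr⟩ := exists_toReal_sub d c
  obtain ⟨s, hs⟩ := exists_toReal_sub a d
  exact ⟨p + q - r - s, by push_cast; rw [hp, hq, hr, hs]; ring⟩

end AngleGrid

namespace AngleGrid

/-- The angle of the `l`-th point of a regular subdivision of the circle in `7 * M` arcs. -/
noncomputable def circleAngle (M l : ℕ) : Real.Angle :=
  ((2 * Real.pi * l / (7 * M : ℕ) : ℝ) : Real.Angle)

theorem circleAngle_add (M l m : ℕ) :
    circleAngle M (l + m) = circleAngle M l + circleAngle M m := by
  simp only [circleAngle, ← Real.Angle.coe_add]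
  congr 1
  push_cast
  ring

theorem toReal_circleAngle_one {M : ℕ} (hM : 0 < M) :
    (circleAngle M 1).toReal = 2 * Real.pi / (7 * M : ℕ) := by
  have h1 : (1 : ℝ) ≤ M := by exact_mod_cast hM
  have hpi := Real.pi_pos
  rw [circleAngle, Nat.cast_one, mul_one, Real.Angle.toReal_coe_eq_self_iff]
  constructor
  · have : (0 : ℝ) < 2 * Real.pi / (7 * M : ℕ) := by positivity
    linarith
  · push_cast
    rw [div_le_iff₀ (by positivity)]
    nlinarith

theorem toReal_two_circleAngle_one {M : ℕ} (hM : 0 < M) :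
    (circleAngle M 1 + circleAngle M 1).toReal = 2 * (2 * Real.pi / (7 * M : ℕ)) := by
  have h1 : (1 : ℝ) ≤ M := by exact_mod_cast hM
  have hpi := Real.pi_pos
  have : circleAngle M 1 + circleAngle M 1 =
      ((2 * (2 * Real.pi / (7 * M : ℕ)) : ℝ) : Real.Angle) := by
    rw [circleAngle, ← Real.Angle.coe_add]
    congr 1
    push_cast
    ring
  rw [this, Real.Angle.toReal_coe_eq_self_iff]
  constructor
  · have : (0 : ℝ) < 2 * (2 * Real.pi / (7 * M : ℕ)) := by positivity
    linarith
  · push_cast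
    rw [← mul_div_assoc, div_le_iff₀ (by positivity)]
    nlinarith

/-- The behaviour on the boundary of the pair of phases of a map from the product of a rectangle
and a disc to `ℂ² ∖ 0`: the map is diagonal linear over two sides of the rectangle, constant along
the other two, and over the boundary of the disc it is equivariant for rotation by a seventh
of a turn acting with weights `1` and `2`. -/
structure BoundaryData (P R K M : ℕ) (α β : AngleGrid) (A B : ℕ → ℕ → Real.Angle) : Prop where
  side_fst : ∀ i j k l, i = 0 ∨ i = P → 1 ≤ k → k ≤ K → α i j k l = A i j + circleAngle M l
  side_snd : ∀ i j k l, i = 0 ∨ i = P → k < K → β i j k l = B i j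
  side_snd_rim : ∀ i j l, i = 0 ∨ i = P → β i j K l = circleAngle M l + circleAngle M l
  const_fst : ∀ i j k l, j = 0 ∨ j = R → α i j k l = α 0 j k l
  const_snd : ∀ i j k l, j = 0 ∨ j = R → β i j k l = β 0 j k l
  center_fst : ∀ i j l, α i j 0 l = α i j 0 0
  center_snd : ∀ i j l, β i j 0 l = β i j 0 0
  rim_fst : ∀ i j l, α i j K (l + M) = α i j K l + circleAngle M M
  rim_snd : ∀ i j l, β i j K (l + M) = β i j K l + (circleAngle M M + circleAngle M M)
  periodic_fst : ∀ i j k l, α i j k (l + 7 * M) = α i j k l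
  periodic_snd : ∀ i j k l, β i j k (l + 7 * M) = β i j k l

namespace BoundaryData

variable {P R K M : ℕ} {α β : AngleGrid} {A B : ℕ → ℕ → Real.Angle}

theorem c023_eq_zero (h : BoundaryData P R K M α β A B) (i j k l : ℕ) (hj : j = 0 ∨ j = R) :
    c023 α β i j k l = 0 := by
  have ha : ∀ i k l, α i j k l = α 0 j k l := fun i k l => h.const_fst i j k l hj
  have hb : ∀ i k l, β i j k l = β 0 j k l := fun i k l => h.const_snd i j k l hj
  simp only [c023, d0, d2, d3, w23, w03, w02, ha (i + 1), ha i, hb (i + 1), hb i]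
  simp

theorem c013_center (h : BoundaryData P R K M α β A B) (i j l : ℕ) : c013 α β i j 0 l = 0 := by
  have ha : ∀ i j l, α i j 0 l = α i j 0 0 := h.center_fst
  have hb : ∀ i j l, β i j 0 l = β i j 0 0 := h.center_snd
  simp only [c013, d0, d1, d3, w13, w03, w01, ha _ _ (l + 1), ha _ _ l, hb _ _ (l + 1), hb _ _ l]
  simp

theorem c012_periodic (h : BoundaryData P R K M α β A B) (i j k : ℕ) :
    c012 α β i j k (7 * M) = c012 α β i j k 0 := by
  have ha : ∀ i j k, α i j k (7 * M) = α i j k 0 := fun i j k => by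
    simpa using h.periodic_fst i j k 0
  have hb : ∀ i j k, β i j k (7 * M) = β i j k 0 := fun i j k => by
    simpa using h.periodic_snd i j k 0
  simp only [c012, d0, d1, d2, w12, w02, w01, ha, hb]

theorem c123_inner (h : BoundaryData P R K M α β A B) (i j k l : ℕ) (hi : i = 0 ∨ i = P)
    (hk : k + 1 < K) : c123 α β i j k l = 0 := by
  have hb : ∀ j k l, k < K → β i j k l = B i j := fun j k l hk => h.side_snd i j k l hi hk
  simp only [c123, d1, d2, d3, w23, w13, w12, hb _ k _ (by omega), hb _ (k + 1) _ hk]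
  simp

theorem c123_rim (h : BoundaryData P R (K + 2) M α β A B) (hM : 0 < M) (i j l : ℕ)
    (hi : i = 0 ∨ i = P) :
    c123 α β i j (K + 1) l = (A i (j + 1) - A i j).toReal * (d2 β i (j + 1) (K + 1) l -
        d2 β i (j + 1) (K + 1) (l + 1) + 2 * (2 * Real.pi / (7 * M : ℕ))) +
      2 * Real.pi / (7 * M : ℕ) * ((B i (j + 1) - B i j).toReal +
        d2 β i (j + 1) (K + 1) (l + 1) - d2 β i j (K + 1) (l + 1)) := by
  have ha : ∀ j k l, 1 ≤ k → k ≤ K + 2 → α i j k l = A i j + circleAngle M l :=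
    fun j k l => h.side_fst i j k l hi
  have hb : ∀ j l, β i j (K + 1) l = B i j := fun j l => h.side_snd i j (K + 1) l hi (by omega)
  have hc : ∀ j l, β i j (K + 1 + 1) l = circleAngle M l + circleAngle M l :=
    fun j l => h.side_snd_rim i j l hi
  have e1 : d1 α i j (K + 1) l = (A i (j + 1) - A i j).toReal := by
    rw [d1, ha _ _ _ (by omega) (by omega), ha _ _ _ (by omega) (by omega)]
    congr 1
    abel
  have e3 : d3 α i j (K + 1) l = 2 * Real.pi / (7 * M : ℕ) := by
    rw [d3, ha _ _ _ (by omega) (by omega), ha _ _ _ (by omega) (by omega), circleAngle_add,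
      ← toReal_circleAngle_one hM]
    congr 1
    abel
  have f3 : ∀ j, d3 β i j (K + 1 + 1) l = 2 * (2 * Real.pi / (7 * M : ℕ)) := fun j => by
    rw [d3, hc, hc, circleAngle_add, ← toReal_two_circleAngle_one hM]
    congr 1
    abel
  have g3 : ∀ j, d3 β i j (K + 1) l = 0 := fun j => by simp [d3, hb]
  have f1 : ∀ l, d1 β i j (K + 1 + 1) l = 0 := fun l => by simp [d1, hc]
  have g1 : d1 β i j (K + 1) (l + 1) = (B i (j + 1) - B i j).toReal := by simp [d1, hb]
  simp only [c123, w23, w13, w12, e1, e3, f1, f3, g1, g3]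
  ring

theorem d2_periodic (h : BoundaryData P R K M α β A B) (i j k l : ℕ) :
    d2 β i j k (l + 7 * M) = d2 β i j k l := by
  simp only [d2, h.periodic_snd]

/-- The contribution of the two sides on which the map is linear. -/
theorem sum_c123 (h : BoundaryData P R (K + 2) M α β A B) (hM : 0 < M) (i : ℕ)
    (hi : i = 0 ∨ i = P) :
    ∑ j ∈ range R, ∑ k ∈ range (K + 2), ∑ l ∈ range (7 * M), c123 α β i j k l =
      2 * Real.pi * ∑ j ∈ range R, (2 * (A i (j + 1) - A i j).toReal + (B i (j + 1) - B i j).toReal)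
      + ∑ l ∈ range (7 * M), 2 * Real.pi / (7 * M : ℕ) *
        (d2 β 0 R (K + 1) (l + 1) - d2 β 0 0 (K + 1) (l + 1)) := by
  have hN : ((7 * M : ℕ) : ℝ) ≠ 0 := by positivity
  have inner : ∀ j, ∑ k ∈ range (K + 2), ∑ l ∈ range (7 * M), c123 α β i j k l =
      ∑ l ∈ range (7 * M), c123 α β i j (K + 1) l := fun j => by
    rw [sum_range_succ, sum_eq_zero, zero_add]
    intro k hk
    exact sum_eq_zero fun l _ => h.c123_inner i j k l hi (by simp at hk; omega)
  have tele : ∀ j, ∑ l ∈ range (7 * M), (d2 β i j (K + 1) l - d2 β i j (K + 1) (l + 1)) = 0 :=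
    fun j => by
    rw [sum_range_sub']
    have := h.d2_periodic i j (K + 1) 0
    rw [zero_add] at this
    rw [this, sub_self]
  have ends : ∀ j l, j = 0 ∨ j = R → d2 β i j (K + 1) l = d2 β 0 j (K + 1) l := fun j l hj => by
    rw [d2, d2, h.const_snd i j _ _ hj, h.const_snd i j _ _ hj]
  have term : ∀ j, ∑ l ∈ range (7 * M), c123 α β i j (K + 1) l =
      2 * Real.pi * (2 * (A i (j + 1) - A i j).toReal + (B i (j + 1) - B i j).toReal) +
      ∑ l ∈ range (7 * M), 2 * Real.pi / (7 * M : ℕ) *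
        (d2 β i (j + 1) (K + 1) (l + 1) - d2 β i j (K + 1) (l + 1)) := fun j => by
    simp only [h.c123_rim hM i j _ hi, sum_add_distrib, ← mul_sum]
    rw [tele]
    simp only [add_sub_assoc, sum_add_distrib, sum_const, card_range, nsmul_eq_mul]
    field_simp
    ring
  simp only [inner, term, sum_add_distrib (s := range R)]
  rw [sum_comm (s := range R), ← mul_sum (s := range R), sum_add_distrib]
  congr 1
  refine sum_congr rfl fun l _ => ?_
  rw [← mul_sum, sum_range_sub (fun j => d2 β i j (K + 1) (l + 1)), ends _ _ (Or.inr rfl),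
    ends _ _ (Or.inl rfl)]

theorem c013_rim_periodic (h : BoundaryData P R K M α β A B) (i j l : ℕ) :
    c013 α β i j K (l + M) = c013 α β i j K l := by
  simp only [c013, d0, d1, d3, w13, w03, w01, add_right_comm l M 1, h.rim_fst, h.rim_snd,
    add_sub_add_right_eq_sub]

theorem sum_w01_rim (h : BoundaryData P R K M α β A B) (l : ℕ) :
    ∑ i ∈ range P, ∑ j ∈ range R, w01 β i j K l = 0 := by
  have hd0 : ∀ i j, j = 0 ∨ j = R → d0 β i j K l = 0 := fun i j hj => by
    rw [d0, h.const_snd (i + 1) j K l hj, h.const_snd i j K l hj]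
    simp
  have hd1 : ∀ i j, i = 0 ∨ i = P → d1 β i j K l = 0 := fun i j hi => by
    simp [d1, h.side_snd_rim _ _ _ hi]
  have split : ∀ i, ∑ j ∈ range R, w01 β i j K l =
      ∑ j ∈ range R, d1 β (i + 1) j K l - ∑ j ∈ range R, d1 β i j K l := fun i => by
    have := sum_range_sub' (fun j => d0 β i j K l) R
    rw [hd0 i 0 (Or.inl rfl), hd0 i R (Or.inr rfl), sub_zero] at this
    rw [← sum_sub_distrib, ← sub_eq_zero, ← sum_sub_distrib, ← this]
    refine sum_congr rfl fun j _ => ?_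
    rw [w01]
    ring
  simp only [split]
  rw [sum_range_sub (fun i => ∑ j ∈ range R, d1 β i j K l)]
  simp [hd1]

/-- On the equivariant side the cup product is, up to exact terms, quantised. -/
theorem exists_c013_eq (α β : AngleGrid) {M : ℕ} (hM : 0 < M) (i j K l : ℕ) :
    let u : ℕ → ℕ → ℕ → ℝ := fun i j l => (α i j K l - circleAngle M l).toReal
    ∃ n : ℤ, c013 α β i j K l =
      (u (i + 1) j l * w13 β (i + 1) j K l - u i j l * w13 β i j K l)
      - (u i (j + 1) l * w03 β i (j + 1) K l - u i j l * w03 β i j K l)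
      + (u i j (l + 1) * w01 β i j K (l + 1) - u i j l * w01 β i j K l)
      + n * (2 * Real.pi) ^ 2 + 2 * Real.pi / (7 * M : ℕ) * w01 β i j K (l + 1) := by
  intro u
  obtain ⟨n0, h0⟩ : ∃ n : ℤ, d0 α i j K l = u (i + 1) j l - u i j l + n * (2 * Real.pi) := by
    rw [d0, ← sub_sub_sub_cancel_right _ _ (circleAngle M l)]
    exact exists_toReal_sub _ _
  obtain ⟨n1, h1⟩ : ∃ n : ℤ, d1 α i j K l = u i (j + 1) l - u i j l + n * (2 * Real.pi) := by
    rw [d1, ← sub_sub_sub_cancel_right _ _ (circleAngle M l)]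
    exact exists_toReal_sub _ _
  obtain ⟨n3, h3⟩ : ∃ n : ℤ, d3 α i j K l =
      u i j (l + 1) - u i j l + 2 * Real.pi / (7 * M : ℕ) + n * (2 * Real.pi) := by
    obtain ⟨n, hn⟩ := exists_toReal_sub (-circleAngle M 1)
      ((α i j K (l + 1) - circleAngle M (l + 1)) - (α i j K l - circleAngle M l))
    obtain ⟨m, hm⟩ := exists_toReal_sub (α i j K l - circleAngle M l)
      (α i j K (l + 1) - circleAngle M (l + 1))
    obtain ⟨r, hr⟩ := exists_toReal_sub (circleAngle M 1) 0
    refine ⟨n + m - r, ?_⟩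
    have e : α i j K (l + 1) - α i j K l = (α i j K (l + 1) - circleAngle M (l + 1)) -
        (α i j K l - circleAngle M l) - -circleAngle M 1 := by
      rw [circleAngle_add]
      abel
    rw [zero_sub, toReal_circleAngle_one hM, Real.Angle.toReal_zero] at hr
    rw [d3, e, hn, hm, hr]
    push_cast
    ring
  obtain ⟨m13, e13⟩ : ∃ n : ℤ, w13 β (i + 1) j K l = n * (2 * Real.pi) := exists_turning _ _ _ _
  obtain ⟨m03, e03⟩ : ∃ n : ℤ, w03 β i (j + 1) K l = n * (2 * Real.pi) := exists_turning _ _ _ _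
  obtain ⟨m01, e01⟩ : ∃ n : ℤ, w01 β i j K (l + 1) = n * (2 * Real.pi) := exists_turning _ _ _ _
  have bianchi : w13 β (i + 1) j K l - w13 β i j K l - (w03 β i (j + 1) K l - w03 β i j K l)
      + (w01 β i j K (l + 1) - w01 β i j K l) = 0 := by
    simp only [w13, w03, w01]
    ring
  refine ⟨n0 * m13 - n1 * m03 + n3 * m01, ?_⟩
  rw [c013, h0, h1, h3]
  push_cast
  linear_combination (n0 * (2 * Real.pi)) * e13 - (n1 * (2 * Real.pi)) * e03
    + (n3 * (2 * Real.pi)) * e01 - u i j l * bianchi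

theorem _root_.Finset.sum_range_mul_of_periodic {f : ℕ → ℝ} {M : ℕ} (hf : ∀ l, f (l + M) = f l)
    (m : ℕ) : ∑ l ∈ range (m * M), f l = m * ∑ l ∈ range M, f l := by
  have hf' : ∀ m l, f (m * M + l) = f l := fun m l => by
    rw [add_comm]
    exact Function.Periodic.nat_mul hf m l
  induction m with
  | zero => simp
  | succ m ih =>
    rw [Nat.succ_mul, sum_range_add, ih]
    simp only [hf']
    push_cast
    ring

/-- The contribution of the equivariant side. -/
theorem sum_c013_rim (h : BoundaryData P R K M α β A B) (hM : 0 < M) :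
    ∃ n : ℤ, ∑ i ∈ range P, ∑ j ∈ range R, ∑ l ∈ range (7 * M), c013 α β i j K l =
      7 * n * (2 * Real.pi) ^ 2 := by
  choose n hn using fun i j l => exists_c013_eq α β hM i j K l
  have h13 : ∀ i j l, i = 0 ∨ i = P → w13 β i j K l = 0 := fun i j l hi => by
    simp [w13, d1, d3, h.side_snd_rim _ _ _ hi]
  have h03 : ∀ i j l, j = 0 ∨ j = R → w03 β i j K l = 0 := fun i j l hj => by
    simp [w03, d0, d3, h.const_snd (i + 1) j K _ hj, h.const_snd i j K _ hj]
  refine ⟨∑ l ∈ range M, ∑ i ∈ range P, ∑ j ∈ range R, n i j l, ?_⟩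
  have per : ∑ i ∈ range P, ∑ j ∈ range R, ∑ l ∈ range (7 * M), c013 α β i j K l =
      7 * ∑ i ∈ range P, ∑ j ∈ range R, ∑ l ∈ range M, c013 α β i j K l := by
    simp only [sum_range_mul_of_periodic (h.c013_rim_periodic _ _), mul_sum, Nat.cast_ofNat]
  rw [per, mul_assoc]
  congr 1
  have hu : ∀ i j, (α i j K M - circleAngle M M).toReal = (α i j K 0 - circleAngle M 0).toReal :=
    fun i j => by
    have e := h.rim_fst i j 0
    rw [zero_add] at e
    rw [e]
    simp [circleAngle]
  have hw : ∀ i j, w01 β i j K M = w01 β i j K 0 := fun i j => by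
    have e := fun i j => h.rim_snd i j 0
    simp only [zero_add] at e
    simp only [w01, d0, d1, e, add_sub_add_right_eq_sub]
  have t0 : ∑ i ∈ range P, ∑ j ∈ range R, ∑ l ∈ range M,
      ((α (i + 1) j K l - circleAngle M l).toReal * w13 β (i + 1) j K l
        - (α i j K l - circleAngle M l).toReal * w13 β i j K l) = 0 := by
    rw [sum_comm]
    refine sum_eq_zero fun j _ => ?_
    rw [sum_comm]
    refine sum_eq_zero fun l _ => ?_
    rw [sum_range_sub (fun i => (α i j K l - circleAngle M l).toReal * w13 β i j K l)]
    simp [h13]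
  have t1 : ∑ i ∈ range P, ∑ j ∈ range R, ∑ l ∈ range M,
      ((α i (j + 1) K l - circleAngle M l).toReal * w03 β i (j + 1) K l
        - (α i j K l - circleAngle M l).toReal * w03 β i j K l) = 0 := by
    refine sum_eq_zero fun i _ => ?_
    rw [sum_comm]
    refine sum_eq_zero fun l _ => ?_
    rw [sum_range_sub (fun j => (α i j K l - circleAngle M l).toReal * w03 β i j K l)]
    simp [h03]
  have t3 : ∑ i ∈ range P, ∑ j ∈ range R, ∑ l ∈ range M,
      ((α i j K (l + 1) - circleAngle M (l + 1)).toReal * w01 β i j K (l + 1)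
        - (α i j K l - circleAngle M l).toReal * w01 β i j K l) = 0 := by
    refine sum_eq_zero fun i _ => sum_eq_zero fun j _ => ?_
    rw [sum_range_sub (fun l => (α i j K l - circleAngle M l).toReal * w01 β i j K l), hu, hw,
      sub_self]
  have t4 : ∑ i ∈ range P, ∑ j ∈ range R, ∑ l ∈ range M,
      2 * Real.pi / (7 * M : ℕ) * w01 β i j K (l + 1) = 0 := by
    simp only [sum_comm (s := range R)]
    rw [sum_comm]
    refine sum_eq_zero fun l _ => ?_
    simp only [← mul_sum, h.sum_w01_rim, mul_zero]
  have split : ∀ i j, ∑ l ∈ range M, c013 α β i j K l =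
      ∑ l ∈ range M, ((α (i + 1) j K l - circleAngle M l).toReal * w13 β (i + 1) j K l
        - (α i j K l - circleAngle M l).toReal * w13 β i j K l)
      - ∑ l ∈ range M, ((α i (j + 1) K l - circleAngle M l).toReal * w03 β i (j + 1) K l
        - (α i j K l - circleAngle M l).toReal * w03 β i j K l)
      + ∑ l ∈ range M, ((α i j K (l + 1) - circleAngle M (l + 1)).toReal * w01 β i j K (l + 1)
        - (α i j K l - circleAngle M l).toReal * w01 β i j K l)
      + ∑ l ∈ range M, n i j l * (2 * Real.pi) ^ 2
      + ∑ l ∈ range M, 2 * Real.pi / (7 * M : ℕ) * w01 β i j K (l + 1) := fun i j => by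
    rw [← sum_sub_distrib, ← sum_add_distrib, ← sum_add_distrib, ← sum_add_distrib]
    exact sum_congr rfl fun l _ => hn i j l
  simp only [split, sum_add_distrib (s := range R), sum_add_distrib (s := range P),
    sum_sub_distrib (s := range P), sum_sub_distrib (s := range R)]
  rw [t0, t1, t3, t4, sum_comm (s := range M)]
  simp only [sum_comm (s := range M), ← sum_mul]
  push_cast
  ring

theorem seven_dvd_turning (h : BoundaryData P R (K + 2) M α β A B) (hM : 0 < M)
    (flat : ∀ i j k l, i < P → j < R → k < K + 2 → l < 7 * M → cup α β i j k l = 0) :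
    ∃ n : ℤ, ∑ j ∈ range R, (2 * (A P (j + 1) - A P j).toReal + (B P (j + 1) - B P j).toReal)
      - ∑ j ∈ range R, (2 * (A 0 (j + 1) - A 0 j).toReal + (B 0 (j + 1) - B 0 j).toReal) =
      7 * n * (2 * Real.pi) := by
  have total := sum_cup α β P R (K + 2) (7 * M)
  rw [sum_eq_zero fun i hi => sum_eq_zero fun j hj => sum_eq_zero fun k hk =>
    sum_eq_zero fun l hl => flat i j k l (mem_range.1 hi) (mem_range.1 hj) (mem_range.1 hk)
      (mem_range.1 hl)] at total
  simp only [h.c023_eq_zero _ _ _ _ (Or.inl rfl), h.c023_eq_zero _ _ _ _ (Or.inr rfl),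
    h.c013_center, h.c012_periodic, sub_self, sum_const_zero, sub_zero, sum_sub_distrib,
    h.sum_c123 hM _ (Or.inl rfl), h.sum_c123 hM _ (Or.inr rfl)] at total
  obtain ⟨n, hn⟩ := h.sum_c013_rim hM
  rw [hn] at total
  refine ⟨-n, ?_⟩
  have hpi : (2 * Real.pi) ≠ 0 := by positivity
  apply mul_left_cancel₀ hpi
  push_cast
  linear_combination -total

end BoundaryData

end AngleGrid

namespace AngleGrid

theorem toReal_arg_sub {z w c : ℂ} (hz : 0 < (z / c).re) (hw : 0 < (w / c).re) :
    ((w.arg : Real.Angle) - z.arg).toReal = (w / c).arg - (z / c).arg := by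
  have hz0 : z / c ≠ 0 := fun h => by simp [h] at hz
  have hw0 : w / c ≠ 0 := fun h => by simp [h] at hw
  have hc : c ≠ 0 := fun h => by simp [h] at hz
  have e : (w.arg : Real.Angle) - z.arg = (((w / c).arg - (z / c).arg : ℝ) : Real.Angle) := by
    rw [Real.Angle.coe_sub, Complex.arg_div_coe_angle (fun h => hw0 (by simp [h])) hc,
      Complex.arg_div_coe_angle (fun h => hz0 (by simp [h])) hc]
    abel
  have h1 := abs_lt.1 (Complex.abs_arg_lt_pi_div_two_iff.2 (Or.inl hz))
  have h2 := abs_lt.1 (Complex.abs_arg_lt_pi_div_two_iff.2 (Or.inl hw))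
  rw [e, Real.Angle.toReal_coe_eq_self_iff]
  constructor <;> linarith

/-- Values of an angle grid on a cube that admit a single-valued logarithm. -/
def Unwound (θ : AngleGrid) (i j k l : ℕ) : Prop :=
  ∃ ψ : ℕ → ℕ → ℕ → ℕ → ℝ, ∀ a b c d a' b' c' d', a ≤ 1 → b ≤ 1 → c ≤ 1 → d ≤ 1 →
    a' ≤ 1 → b' ≤ 1 → c' ≤ 1 → d' ≤ 1 →
    (θ (i + a') (j + b') (k + c') (l + d') - θ (i + a) (j + b) (k + c) (l + d)).toReal =
      ψ a' b' c' d' - ψ a b c d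

theorem Unwound.of_arg {θ : AngleGrid} {i j k l : ℕ} (z : ℕ → ℕ → ℕ → ℕ → ℂ) (c : ℂ)
    (h : ∀ a b e d, a ≤ 1 → b ≤ 1 → e ≤ 1 → d ≤ 1 → 0 < (z a b e d / c).re ∧
      θ (i + a) (j + b) (k + e) (l + d) = (z a b e d).arg) : Unwound θ i j k l := by
  refine ⟨fun a b e d => (z a b e d / c).arg, fun a b e d a' b' e' d' h1 h2 h3 h4 h5 h6 h7 h8 => ?_⟩
  rw [(h a b e d h1 h2 h3 h4).2, (h a' b' e' d' h5 h6 h7 h8).2]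
  exact toReal_arg_sub (h a b e d h1 h2 h3 h4).1 (h a' b' e' d' h5 h6 h7 h8).1

section

variable {θ η : AngleGrid} {i j k l : ℕ}

theorem Unwound.w01_eq_zero (h : Unwound θ i j k l) {a b : ℕ} (ha : a ≤ 1) (hb : b ≤ 1) :
    w01 θ i j (k + a) (l + b) = 0 := by
  obtain ⟨ψ, h⟩ := h
  have h1 := h 0 0 a b 1 0 a b
  have h2 := h 1 0 a b 1 1 a b
  have h3 := h 0 1 a b 1 1 a b
  have h4 := h 0 0 a b 0 1 a b
  simp only [zero_le, le_refl, ha, hb, forall_const, add_zero] at h1 h2 h3 h4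
  simp only [w01, d0, d1, h1, h2, h3, h4]
  ring

theorem Unwound.w02_eq_zero (h : Unwound θ i j k l) {a b : ℕ} (ha : a ≤ 1) (hb : b ≤ 1) :
    w02 θ i (j + a) k (l + b) = 0 := by
  obtain ⟨ψ, h⟩ := h
  have h1 := h 0 a 0 b 1 a 0 b
  have h2 := h 1 a 0 b 1 a 1 b
  have h3 := h 0 a 1 b 1 a 1 b
  have h4 := h 0 a 0 b 0 a 1 b
  simp only [zero_le, le_refl, ha, hb, forall_const, add_zero] at h1 h2 h3 h4
  simp only [w02, d0, d2, h1, h2, h3, h4]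
  ring

theorem Unwound.w03_eq_zero (h : Unwound θ i j k l) {a b : ℕ} (ha : a ≤ 1) (hb : b ≤ 1) :
    w03 θ i (j + a) (k + b) l = 0 := by
  obtain ⟨ψ, h⟩ := h
  have h1 := h 0 a b 0 1 a b 0
  have h2 := h 1 a b 0 1 a b 1
  have h3 := h 0 a b 1 1 a b 1
  have h4 := h 0 a b 0 0 a b 1
  simp only [zero_le, le_refl, ha, hb, forall_const, add_zero] at h1 h2 h3 h4
  simp only [w03, d0, d3, h1, h2, h3, h4]
  ring

theorem Unwound.w12_eq_zero (h : Unwound θ i j k l) {a b : ℕ} (ha : a ≤ 1) (hb : b ≤ 1) :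
    w12 θ (i + a) j k (l + b) = 0 := by
  obtain ⟨ψ, h⟩ := h
  have h1 := h a 0 0 b a 1 0 b
  have h2 := h a 1 0 b a 1 1 b
  have h3 := h a 0 1 b a 1 1 b
  have h4 := h a 0 0 b a 0 1 b
  simp only [zero_le, le_refl, ha, hb, forall_const, add_zero] at h1 h2 h3 h4
  simp only [w12, d1, d2, h1, h2, h3, h4]
  ring

theorem Unwound.w13_eq_zero (h : Unwound θ i j k l) {a b : ℕ} (ha : a ≤ 1) (hb : b ≤ 1) :
    w13 θ (i + a) j (k + b) l = 0 := by
  obtain ⟨ψ, h⟩ := h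
  have h1 := h a 0 b 0 a 1 b 0
  have h2 := h a 1 b 0 a 1 b 1
  have h3 := h a 0 b 1 a 1 b 1
  have h4 := h a 0 b 0 a 0 b 1
  simp only [zero_le, le_refl, ha, hb, forall_const, add_zero] at h1 h2 h3 h4
  simp only [w13, d1, d3, h1, h2, h3, h4]
  ring

theorem Unwound.w23_eq_zero (h : Unwound θ i j k l) {a b : ℕ} (ha : a ≤ 1) (hb : b ≤ 1) :
    w23 θ (i + a) (j + b) k l = 0 := by
  obtain ⟨ψ, h⟩ := h
  have h1 := h a b 0 0 a b 1 0
  have h2 := h a b 1 0 a b 1 1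
  have h3 := h a b 0 1 a b 1 1
  have h4 := h a b 0 0 a b 0 1
  simp only [zero_le, le_refl, ha, hb, forall_const, add_zero] at h1 h2 h3 h4
  simp only [w23, d2, d3, h1, h2, h3, h4]
  ring

theorem cup_eq_zero_of_left (h : Unwound θ i j k l) : cup θ η i j k l = 0 := by
  have h01 := h.w01_eq_zero zero_le_one zero_le_one
  have h02 := h.w02_eq_zero zero_le_one zero_le_one
  have h03 := h.w03_eq_zero zero_le_one zero_le_one
  have h12 := h.w12_eq_zero zero_le_one zero_le_one
  have h13 := h.w13_eq_zero zero_le_one zero_le_one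
  have h23 := h.w23_eq_zero zero_le_one zero_le_one
  simp only [add_zero] at h01 h02 h03 h12 h13 h23
  simp only [cup, h01, h02, h03, h12, h13, h23]
  ring

theorem cup_eq_zero_of_right (h : Unwound η i j k l) : cup θ η i j k l = 0 := by
  have h01 := h.w01_eq_zero le_rfl le_rfl
  have h02 := h.w02_eq_zero le_rfl le_rfl
  have h03 := h.w03_eq_zero le_rfl le_rfl
  have h12 := h.w12_eq_zero le_rfl le_rfl
  have h13 := h.w13_eq_zero le_rfl le_rfl
  have h23 := h.w23_eq_zero le_rfl le_rfl
  simp only [cup, h01, h02, h03, h12, h13, h23]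
  ring

end

end AngleGrid

/-- The point of the unit circle at `φ` turns from `1`. -/
noncomputable def expTurn (φ : ℝ) : ℂ := Complex.exp (((2 * Real.pi * φ : ℝ) : ℂ) * Complex.I)

theorem expTurn_add (x y : ℝ) : expTurn (x + y) = expTurn x * expTurn y := by
  rw [expTurn, expTurn, expTurn, ← Complex.exp_add]
  congr 1
  push_cast
  ring

@[simp] theorem norm_expTurn (x : ℝ) : ‖expTurn x‖ = 1 := Complex.norm_exp_ofReal_mul_I _

theorem expTurn_ne_zero (x : ℝ) : expTurn x ≠ 0 := Complex.exp_ne_zero _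

@[simp] theorem expTurn_zero : expTurn 0 = 1 := by simp [expTurn]

@[simp] theorem expTurn_one : expTurn 1 = 1 := by simp [expTurn]

@[fun_prop] theorem continuous_expTurn : Continuous expTurn := by
  unfold expTurn
  fun_prop

theorem arg_expTurn (x : ℝ) : ((expTurn x).arg : Real.Angle) = ((2 * Real.pi * x : ℝ) : Real.Angle) := by
  rw [expTurn, Complex.exp_mul_I, ← Complex.ofReal_cos, ← Complex.ofReal_sin,
    ← Real.Angle.cos_coe, ← Real.Angle.sin_coe]
  exact Complex.arg_cos_add_sin_mul_I_coe_angle _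

theorem arg_mul_expTurn {z : ℂ} (hz : z ≠ 0) (x : ℝ) :
    ((z * expTurn x).arg : Real.Angle) = z.arg + ((2 * Real.pi * x : ℝ) : Real.Angle) := by
  rw [Complex.arg_mul_coe_angle hz (expTurn_ne_zero x), arg_expTurn]

theorem re_div_pos_of_dist_lt {z c : ℂ} (h : dist z c < ‖c‖) : 0 < (z / c).re := by
  have hc : c ≠ 0 := fun h0 => by
    rw [h0, norm_zero] at h
    exact absurd h (not_lt.2 dist_nonneg)
  have h1 : ‖z / c - 1‖ < 1 := by
    rw [div_sub_one hc, norm_div, div_lt_one (norm_pos_iff.2 hc), ← dist_eq_norm]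
    exact h
  have h2 := (abs_lt.1 ((Complex.abs_re_le_norm _).trans_lt h1)).1
  rw [Complex.sub_re, Complex.one_re] at h2
  linarith

namespace AngleGrid

/-- The points of the regular grid of mesh `1 / n`, refined seven times in the last direction. -/
noncomputable def gridPoint (n i j k l : ℕ) : ℝ × ℝ × ℝ × ℝ :=
  (i / n, j / n, k / n, l / (7 * n : ℕ))

/-- The phases of `f` along the grid, where on the rim of the disc the phase of a zero is
that of a uniform rotation of weight `w`. -/
noncomputable def phase (f : ℝ × ℝ × ℝ × ℝ → ℂ) (w : ℝ) (n i j k l : ℕ) : Real.Angle :=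
  if k = n then ((2 * Real.pi * (w * (l / (7 * n : ℕ))) : ℝ) : Real.Angle) +
    (f (gridPoint n i j k l) * expTurn (-(w * (l / (7 * n : ℕ))))).arg
  else (f (gridPoint n i j k l)).arg

theorem phase_of_ne_zero {f : ℝ × ℝ × ℝ × ℝ → ℂ} {w : ℝ} {n i j k l : ℕ}
    (h : f (gridPoint n i j k l) ≠ 0) : phase f w n i j k l = (f (gridPoint n i j k l)).arg := by
  unfold phase
  split_ifs
  · rw [arg_mul_expTurn h, mul_neg, Real.Angle.coe_neg]
    abel
  · rfl

theorem phase_of_ne {f : ℝ × ℝ × ℝ × ℝ → ℂ} {w : ℝ} {n i j k l : ℕ} (hk : k ≠ n) :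
    phase f w n i j k l = (f (gridPoint n i j k l)).arg := if_neg hk

theorem gridPoint_mem {n i j k l : ℕ} (hi : i ≤ n) (hj : j ≤ n) (hk : k ≤ n) (hl : l ≤ 7 * n) :
    gridPoint n i j k l ∈ Set.Icc (0 : ℝ × ℝ × ℝ × ℝ) 1 := by
  have key : ∀ a b : ℕ, a ≤ b → (0 : ℝ) ≤ a / b ∧ (a / b : ℝ) ≤ 1 := fun a b hab =>
    ⟨by positivity, div_le_one_of_le₀ (by exact_mod_cast hab) (by positivity)⟩
  exact ⟨⟨(key _ _ hi).1, (key _ _ hj).1, (key _ _ hk).1, (key _ _ hl).1⟩,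
    ⟨(key _ _ hi).2, (key _ _ hj).2, (key _ _ hk).2, (key _ _ hl).2⟩⟩

theorem dist_gridPoint_le {n i j k l a b c d : ℕ} (ha : a ≤ 1) (hb : b ≤ 1)
    (hc : c ≤ 1) (hd : d ≤ 1) :
    dist (gridPoint n (i + a) (j + b) (k + c) (l + d)) (gridPoint n i j k l) ≤ 1 / n := by
  have key : ∀ p q m : ℕ, q ≤ 1 → dist (((p + q : ℕ) : ℝ) / m) (p / m) ≤ 1 / m := fun p q m hq => by
    rw [Real.dist_eq, ← sub_div, Nat.cast_add, add_sub_cancel_left, abs_of_nonneg (by positivity)]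
    gcongr
    exact_mod_cast hq
  have h7 : (1 : ℝ) / (7 * n : ℕ) ≤ 1 / n := by
    rcases Nat.eq_zero_or_pos n with rfl | hn
    · simp
    · apply one_div_le_one_div_of_le (by positivity)
      exact_mod_cast (by omega : n ≤ 7 * n)
  simp only [gridPoint, Prod.dist_eq, max_le_iff]
  exact ⟨key _ _ _ ha, key _ _ _ hb, key _ _ _ hc, (key _ _ _ hd).trans h7⟩

theorem unwound_phase {f : ℝ × ℝ × ℝ × ℝ → ℂ} {w ε δ : ℝ} {n i j k l : ℕ}
    (hf : ∀ x ∈ Set.Icc (0 : ℝ × ℝ × ℝ × ℝ) 1, ∀ y ∈ Set.Icc (0 : ℝ × ℝ × ℝ × ℝ) 1,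
      dist x y < δ → dist (f x) (f y) < ε) (hn : 1 / (n : ℝ) < δ)
    (hi : i < n) (hj : j < n) (hk : k < n) (hl : l < 7 * n)
    (h : ε ≤ ‖f (gridPoint n i j k l)‖) : Unwound (phase f w n) i j k l := by
  refine Unwound.of_arg (fun a b e d => f (gridPoint n (i + a) (j + b) (k + e) (l + d)))
    (f (gridPoint n i j k l)) fun a b e d ha hb he hd => ?_
  have h1 := re_div_pos_of_dist_lt ((hf _ (gridPoint_mem (by omega) (by omega) (by omega)
    (by omega)) _ (gridPoint_mem hi.le hj.le hk.le hl.le)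
    ((dist_gridPoint_le ha hb he hd).trans_lt hn)).trans_le h)
  exact ⟨h1, phase_of_ne_zero fun h0 => by simp [h0] at h1⟩

/-- For a continuous map to `ℂ² ∖ 0` the phases are flat on a fine grid. -/
theorem eventually_cup_phase_eq_zero {f g : ℝ × ℝ × ℝ × ℝ → ℂ} (hf : Continuous f)
    (hg : Continuous g) (hne : ∀ x ∈ Set.Icc (0 : ℝ × ℝ × ℝ × ℝ) 1, f x ≠ 0 ∨ g x ≠ 0) (v w : ℝ) :
    ∀ᶠ n : ℕ in Filter.atTop, ∀ i j k l, i < n → j < n → k < n → l < 7 * n →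
      cup (phase f v n) (phase g w n) i j k l = 0 := by
  have hc : IsCompact (Set.Icc (0 : ℝ × ℝ × ℝ × ℝ) 1) := isCompact_Icc
  obtain ⟨x₀, hx₀, hmin⟩ := hc.exists_isMinOn
    ⟨0, Set.left_mem_Icc.2 zero_le_one⟩ (f := fun x => ‖f x‖ ⊔ ‖g x‖)
    (by fun_prop)
  obtain ⟨δ₁, hδ₁, h₁⟩ := Metric.uniformContinuousOn_iff.1
    (hc.uniformContinuousOn_of_continuous hf.continuousOn) (‖f x₀‖ ⊔ ‖g x₀‖)
    (by rcases hne x₀ hx₀ with h | h <;> simp [h])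
  obtain ⟨δ₂, hδ₂, h₂⟩ := Metric.uniformContinuousOn_iff.1
    (hc.uniformContinuousOn_of_continuous hg.continuousOn) (‖f x₀‖ ⊔ ‖g x₀‖)
    (by rcases hne x₀ hx₀ with h | h <;> simp [h])
  filter_upwards [tendsto_one_div_atTop_nhds_zero_nat.eventually_lt_const hδ₁,
    tendsto_one_div_atTop_nhds_zero_nat.eventually_lt_const hδ₂] with n hn₁ hn₂ i j k l hi hj hk hl
  have hmax : ‖f x₀‖ ⊔ ‖g x₀‖ ≤ ‖f (gridPoint n i j k l)‖ ⊔ ‖g (gridPoint n i j k l)‖ :=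
    hmin (gridPoint_mem hi.le hj.le hk.le hl.le)
  rcases le_max_iff.1 hmax with h | h
  · exact cup_eq_zero_of_left (unwound_phase h₁ hn₁ hi hj hk hl h)
  · exact cup_eq_zero_of_right (unwound_phase h₂ hn₂ hi hj hk hl h)

end AngleGrid

/-- The symmetries of a map `(f, g)` from the product of the unit square and a disc to `ℂ²`, the
disc being given in polar coordinates `(σ, φ)`: over two sides of the square it is the
diagonal linear map with entries `a`, `b` on the points `(σ e(φ), √(1 - σ²))`, along the two others it
is constant, and on the boundary of the disc it is equivariant for the rotation of order seven. -/
structure DiscFamily (f g : ℝ × ℝ × ℝ × ℝ → ℂ) (a b : ℝ → ℝ → ℂ) : Prop where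
  side_fst : ∀ t s σ φ, t = 0 ∨ t = 1 → σ ∈ Set.Icc (0 : ℝ) 1 → f (t, s, σ, φ) = a t s * expTurn φ * σ
  side_snd : ∀ t s σ φ, t = 0 ∨ t = 1 → σ ∈ Set.Icc (0 : ℝ) 1 → g (t, s, σ, φ) = b t s * √(1 - σ ^ 2)
  side_ne : ∀ t s, t = 0 ∨ t = 1 → a t s ≠ 0
  const_fst : ∀ t s σ φ, s = 0 ∨ s = 1 → f (t, s, σ, φ) = f (0, s, σ, φ)
  const_snd : ∀ t s σ φ, s = 0 ∨ s = 1 → g (t, s, σ, φ) = g (0, s, σ, φ)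
  center_fst : ∀ t s φ, f (t, s, 0, φ) = f (t, s, 0, 0)
  center_snd : ∀ t s φ, g (t, s, 0, φ) = g (t, s, 0, 0)
  rim_fst : ∀ t s φ, f (t, s, 1, φ + 1 / 7) = f (t, s, 1, φ) * expTurn (1 / 7)
  rim_snd : ∀ t s φ, g (t, s, 1, φ + 1 / 7) = g (t, s, 1, φ) * expTurn (2 / 7)
  periodic_fst : ∀ t s σ φ, f (t, s, σ, φ + 1) = f (t, s, σ, φ)
  periodic_snd : ∀ t s σ φ, g (t, s, σ, φ + 1) = g (t, s, σ, φ)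

namespace AngleGrid

theorem phase_add_of_rim {f : ℝ × ℝ × ℝ × ℝ → ℂ} {w : ℝ} {n : ℕ} (hn : 0 < n)
    (hf : ∀ t s φ, f (t, s, 1, φ + 1 / 7) = f (t, s, 1, φ) * expTurn (w / 7)) (i j l : ℕ) :
    phase f w n i j n (l + n) = phase f w n i j n l + ((2 * Real.pi * (w / 7) : ℝ) : Real.Angle) := by
  have hn' : (n : ℝ) ≠ 0 := by positivity
  have e : ((l + n : ℕ) : ℝ) / (7 * n : ℕ) = l / (7 * n : ℕ) + 1 / 7 := by
    push_cast
    field_simp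
  have e1 : -(w * ((l : ℝ) / (7 * n : ℕ) + 1 / 7)) = -(w / 7) + -(w * (l / (7 * n : ℕ))) := by ring
  have e2 : expTurn (w / 7) * expTurn (-(w / 7)) = 1 := by rw [← expTurn_add, add_neg_cancel, expTurn_zero]
  simp only [phase, if_true, gridPoint, e, div_self hn', hf, e1]
  rw [expTurn_add, mul_assoc (f _), ← mul_assoc (expTurn (w / 7)), e2, one_mul, add_right_comm,
    ← Real.Angle.coe_add]
  congr 3
  ring

theorem phase_periodic {f : ℝ × ℝ × ℝ × ℝ → ℂ} {w : ℤ} {n : ℕ} (hn : 0 < n)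
    (hf : ∀ t s σ φ, f (t, s, σ, φ + 1) = f (t, s, σ, φ)) (i j k l : ℕ) :
    phase f w n i j k (l + 7 * n) = phase f w n i j k l := by
  have hn' : ((7 * n : ℕ) : ℝ) ≠ 0 := by positivity
  have e : ((l + 7 * n : ℕ) : ℝ) / (7 * n : ℕ) = l / (7 * n : ℕ) + 1 := by
    rw [Nat.cast_add, add_div, div_self hn']
  have e1 : (w : ℝ) * ((l : ℝ) / (7 * n : ℕ) + 1) = w * (l / (7 * n : ℕ)) + w := by ring
  have e2 : expTurn (-w) = 1 := by
    rw [expTurn, Complex.exp_eq_one_iff]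
    exact ⟨-w, by push_cast; ring⟩
  have e3 : ((2 * Real.pi * w : ℝ) : Real.Angle) = 0 :=
    Real.Angle.coe_eq_zero_iff.2 ⟨w, by simp [mul_comm]⟩
  simp only [phase, gridPoint, e, hf, e1, neg_add, expTurn_add, e2, mul_one, mul_add,
    Real.Angle.coe_add, e3, add_zero]

end AngleGrid

open AngleGrid in
theorem DiscFamily.boundaryData {f g : ℝ × ℝ × ℝ × ℝ → ℂ} {a b : ℝ → ℝ → ℂ} (h : DiscFamily f g a b)
    {n : ℕ} (hn : 0 < n) : BoundaryData n n n n (phase f 1 n) (phase g 2 n)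
      (fun i j => (a (i / n) (j / n)).arg) (fun i j => (b (i / n) (j / n)).arg) := by
  have hn' : (n : ℝ) ≠ 0 := by positivity
  have end_eq : ∀ i : ℕ, i = 0 ∨ i = n → (i / n : ℝ) = 0 ∨ (i / n : ℝ) = 1 := by
    rintro i (rfl | rfl)
    · left; simp
    · right; exact div_self hn'
  have mem : ∀ k : ℕ, k ≤ n → (k / n : ℝ) ∈ Set.Icc (0 : ℝ) 1 := fun k hk =>
    ⟨by positivity, div_le_one_of_le₀ (by exact_mod_cast hk) (by positivity)⟩
  have full1 : circleAngle n n = ((2 * Real.pi * (1 / 7) : ℝ) : Real.Angle) := by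
    rw [circleAngle]
    congr 1
    push_cast
    field_simp
  have full2 : circleAngle n n + circleAngle n n = ((2 * Real.pi * (2 / 7) : ℝ) : Real.Angle) := by
    rw [full1, ← Real.Angle.coe_add]
    congr 1
    ring
  have two : ∀ l : ℕ, ((2 * Real.pi * (2 * (l / (7 * n : ℕ))) : ℝ) : Real.Angle) =
      circleAngle n l + circleAngle n l := fun l => by
    rw [circleAngle, ← Real.Angle.coe_add]
    congr 1
    ring
  have zero_cast : ((0 : ℕ) : ℝ) / n = 0 := by simp
  constructor
  · intro i j k l hi hk1 hkn
    have hk : (0 : ℝ) < k / n := by positivity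
    have e := h.side_fst (i / n) (j / n) (k / n) (l / (7 * n : ℕ)) (end_eq i hi) (mem k hkn)
    have ha := h.side_ne (i / n) (j / n) (end_eq i hi)
    have hne : f (gridPoint n i j k l) ≠ 0 := by
      rw [gridPoint, e]
      exact mul_ne_zero (mul_ne_zero ha (expTurn_ne_zero _)) (by exact_mod_cast hk.ne')
    rw [phase_of_ne_zero hne, gridPoint, e, Complex.arg_mul_real hk, arg_mul_expTurn ha, circleAngle,
      mul_div_assoc]
  · intro i j k l hi hkn
    have hk : (k / n : ℝ) < 1 := by
      rw [div_lt_one (by positivity)]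
      exact_mod_cast hkn
    have hk0 : (0 : ℝ) ≤ k / n := by positivity
    have e := h.side_snd (i / n) (j / n) (k / n) (l / (7 * n : ℕ)) (end_eq i hi) (mem k hkn.le)
    rw [phase_of_ne hkn.ne, gridPoint, e, Complex.arg_mul_real (Real.sqrt_pos.2 (by nlinarith))]
  · intro i j l hi
    have e := h.side_snd (i / n) (j / n) (n / n) (l / (7 * n : ℕ)) (end_eq i hi) (mem n le_rfl)
    rw [div_self hn'] at e
    simp only [phase, if_true, gridPoint, div_self hn', e, two]
    simp
  · intro i j k l hj
    simp only [phase, gridPoint, h.const_fst (i / n) (j / n) _ _ (end_eq j hj), zero_cast]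
  · intro i j k l hj
    simp only [phase, gridPoint, h.const_snd (i / n) (j / n) _ _ (end_eq j hj), zero_cast]
  · intro i j l
    rw [phase_of_ne hn.ne, phase_of_ne hn.ne, gridPoint, gridPoint, zero_cast, h.center_fst _ _ (_ / _),
      h.center_fst _ _ (((0 : ℕ) : ℝ) / _)]
  · intro i j l
    rw [phase_of_ne hn.ne, phase_of_ne hn.ne, gridPoint, gridPoint, zero_cast, h.center_snd _ _ (_ / _),
      h.center_snd _ _ (((0 : ℕ) : ℝ) / _)]
  · intro i j l
    rw [full1]
    exact phase_add_of_rim hn h.rim_fst i j l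
  · intro i j l
    rw [full2]
    exact phase_add_of_rim hn h.rim_snd i j l
  · intro i j k l
    exact_mod_cast phase_periodic (w := 1) hn h.periodic_fst i j k l
  · intro i j k l
    exact_mod_cast phase_periodic (w := 2) hn h.periodic_snd i j k l

open AngleGrid in
theorem DiscFamily.seven_dvd_turning {f g : ℝ × ℝ × ℝ × ℝ → ℂ} {a b : ℝ → ℝ → ℂ}
    (h : DiscFamily f g a b) (hf : Continuous f) (hg : Continuous g)
    (hne : ∀ x ∈ Set.Icc (0 : ℝ × ℝ × ℝ × ℝ) 1, f x ≠ 0 ∨ g x ≠ 0) :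
    ∀ᶠ n : ℕ in Filter.atTop, ∃ m : ℤ,
      ∑ j ∈ range n, (2 * (((a 1 ((j + 1 : ℕ) / n)).arg : Real.Angle) - (a 1 (j / n)).arg).toReal +
        (((b 1 ((j + 1 : ℕ) / n)).arg : Real.Angle) - (b 1 (j / n)).arg).toReal)
      - ∑ j ∈ range n, (2 * (((a 0 ((j + 1 : ℕ) / n)).arg : Real.Angle) - (a 0 (j / n)).arg).toReal +
        (((b 0 ((j + 1 : ℕ) / n)).arg : Real.Angle) - (b 0 (j / n)).arg).toReal) =
      7 * m * (2 * Real.pi) := by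
  filter_upwards [eventually_cup_phase_eq_zero hf hg hne 1 2, Filter.eventually_ge_atTop 2]
    with n flat hn
  obtain ⟨K, rfl⟩ := Nat.exists_eq_add_of_le' hn
  obtain ⟨m, hm⟩ := (h.boundaryData (n := K + 2) (by omega)).seven_dvd_turning (by omega) flat
  have e0 : ((0 : ℕ) : ℝ) / (K + 2 : ℕ) = 0 := by simp
  have e1 : ((K + 2 : ℕ) : ℝ) / (K + 2 : ℕ) = 1 := div_self (by positivity)
  refine ⟨m, ?_⟩
  rw [← hm]
  simp only [e0, e1]

/-- A tent function on `[0, 1]`, and two cutoffs with which it interpolates. -/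
noncomputable def tent (s : ℝ) : ℝ := max 0 (min 1 (min (4 * s) (4 - 4 * s)))
noncomputable def cutLeft (s : ℝ) : ℝ := max 0 (min 1 (2 - 4 * s))
noncomputable def cutRight (s : ℝ) : ℝ := max 0 (min 1 (4 * s - 2))

@[fun_prop] theorem continuous_tent : Continuous tent := by unfold tent; fun_prop
@[fun_prop] theorem continuous_cutLeft : Continuous cutLeft := by unfold cutLeft; fun_prop
@[fun_prop] theorem continuous_cutRight : Continuous cutRight := by unfold cutRight; fun_prop

theorem tent_nonneg (s : ℝ) : 0 ≤ tent s := le_max_left _ _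
theorem cutLeft_nonneg (s : ℝ) : 0 ≤ cutLeft s := le_max_left _ _
theorem cutRight_nonneg (s : ℝ) : 0 ≤ cutRight s := le_max_left _ _

theorem cutRight_eq_zero {s : ℝ} (hs : s ≤ 1 / 2) : cutRight s = 0 :=
  max_eq_left ((min_le_right _ _).trans (by linarith))

theorem cutLeft_eq_zero {s : ℝ} (hs : 1 / 2 ≤ s) : cutLeft s = 0 :=
  max_eq_left ((min_le_right _ _).trans (by linarith))

theorem tent_add_cutLeft_pos {s : ℝ} (hs : s ≤ 1 / 2) : 0 < tent s + cutLeft s := by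
  rcases lt_or_ge s (1 / 2) with h | h
  · exact add_pos_of_nonneg_of_pos (tent_nonneg s)
      (lt_max_of_lt_right (lt_min one_pos (by linarith)))
  · exact add_pos_of_pos_of_nonneg (lt_max_of_lt_right (lt_min one_pos
      (lt_min (by linarith) (by linarith)))) (cutLeft_nonneg s)

theorem tent_add_cutRight_pos {s : ℝ} (hs : 1 / 2 ≤ s) : 0 < tent s + cutRight s := by
  rcases lt_or_ge (1 / 2) s with h | h
  · exact add_pos_of_nonneg_of_pos (tent_nonneg s)
      (lt_max_of_lt_right (lt_min one_pos (by linarith)))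
  · exact add_pos_of_pos_of_nonneg (lt_max_of_lt_right (lt_min one_pos
      (lt_min (by linarith) (by linarith)))) (cutRight_nonneg s)

/-- The piecewise linear path from `-v` to `u` to `-w`. -/
noncomputable def cornerPath (u v w : ℂ) (s : ℝ) : ℂ := tent s * u - cutLeft s * v - cutRight s * w

theorem cornerPath_zero (u v w : ℂ) : cornerPath u v w 0 = -v := by
  simp [cornerPath, tent, cutLeft, cutRight]

theorem cornerPath_half (u v w : ℂ) : cornerPath u v w (1 / 2) = u := by
  norm_num [cornerPath, tent, cutLeft, cutRight]

theorem cornerPath_one (u v w : ℂ) : cornerPath u v w 1 = -w := by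
  norm_num [cornerPath, tent, cutLeft, cutRight]

theorem re_segment_div {u v : ℂ} (hu : ‖u‖ = 1) (hv : ‖v‖ = 1) (huv : u ≠ v) (p q : ℝ) :
    ((p * u - q * v) / (u - v)).re = (p + q) / 2 := by
  have hc : u - v ≠ 0 := sub_ne_zero.2 huv
  have h0 : ((u + v) / (u - v)).re = 0 := by
    rw [Complex.div_re, ← add_div, div_eq_zero_iff]
    left
    have h1 : u.re * u.re + u.im * u.im = 1 := by
      rw [← Complex.normSq_apply, Complex.normSq_eq_norm_sq, hu, one_pow]
    have h2 : v.re * v.re + v.im * v.im = 1 := by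
      rw [← Complex.normSq_apply, Complex.normSq_eq_norm_sq, hv, one_pow]
    simp only [Complex.add_re, Complex.sub_re, Complex.add_im, Complex.sub_im]
    linear_combination h1 - h2
  have e : (p * u - q * v) / (u - v) =
      (((p + q) / 2 : ℝ) : ℂ) + (((p - q) / 2 : ℝ) : ℂ) * ((u + v) / (u - v)) := by
    push_cast
    field_simp
    ring
  rw [e, Complex.add_re, Complex.re_ofReal_mul, h0, Complex.ofReal_re, mul_zero, add_zero]

theorem re_cornerPath_div_left {u v : ℂ} (hu : ‖u‖ = 1) (hv : ‖v‖ = 1) (huv : u ≠ v) (w : ℂ) {s : ℝ}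
    (hs : s ≤ 1 / 2) : 0 < (cornerPath u v w s / (u - v)).re := by
  rw [cornerPath, cutRight_eq_zero hs, Complex.ofReal_zero, zero_mul, sub_zero,
    re_segment_div hu hv huv]
  exact half_pos (tent_add_cutLeft_pos hs)

theorem re_cornerPath_div_right {u w : ℂ} (hu : ‖u‖ = 1) (hw : ‖w‖ = 1) (huw : u ≠ w) (v : ℂ) {s : ℝ}
    (hs : 1 / 2 ≤ s) : 0 < (cornerPath u v w s / (u - w)).re := by
  rw [cornerPath, cutLeft_eq_zero hs, Complex.ofReal_zero, zero_mul, sub_zero,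
    re_segment_div hu hw huw]
  exact half_pos (tent_add_cutRight_pos hs)

theorem cornerPath_ne_zero {u v w : ℂ} (hu : ‖u‖ = 1) (hv : ‖v‖ = 1) (hw : ‖w‖ = 1) (huv : u ≠ v)
    (huw : u ≠ w) (s : ℝ) : cornerPath u v w s ≠ 0 := fun h0 => by
  rcases le_total s (1 / 2) with hs | hs
  · simpa [h0] using re_cornerPath_div_left hu hv huv w hs
  · simpa [h0] using re_cornerPath_div_right hu hw huw v hs

namespace AngleGrid

theorem sum_toReal_arg_sub {z : ℕ → ℂ} {c : ℂ} {m : ℕ} (h : ∀ j ≤ m, 0 < (z j / c).re) :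
    ∑ j ∈ range m, (((z (j + 1)).arg : Real.Angle) - (z j).arg).toReal =
      (((z m).arg : Real.Angle) - (z 0).arg).toReal := by
  rw [toReal_arg_sub (h 0 (Nat.zero_le _)) (h m le_rfl), ← sum_range_sub (fun j => (z j / c).arg)]
  exact sum_congr rfl fun j hj => toReal_arg_sub (h j (mem_range.1 hj).le) (h _ (mem_range.1 hj))

theorem sum_toReal_arg_cornerPath {u v w : ℂ} (hu : ‖u‖ = 1) (hv : ‖v‖ = 1) (hw : ‖w‖ = 1)
    (huv : u ≠ v) (huw : u ≠ w) {m : ℕ} (hm : 0 < m) :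
    ∑ j ∈ range (m + m), (((cornerPath u v w ((j + 1 : ℕ) / (m + m : ℕ))).arg : Real.Angle) -
      (cornerPath u v w (j / (m + m : ℕ))).arg).toReal =
    ((u.arg : Real.Angle) - (-v).arg).toReal + (((-w).arg : Real.Angle) - u.arg).toReal := by
  have hm' : (0 : ℝ) < m := by exact_mod_cast hm
  have e0 : ((0 : ℕ) : ℝ) / (m + m : ℕ) = 0 := by simp
  have e1 : ((m : ℕ) : ℝ) / (m + m : ℕ) = 1 / 2 := by
    push_cast
    field_simp
    norm_num
  have e2 : ((m + m : ℕ) : ℝ) / (m + m : ℕ) = 1 := div_self (by positivity)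
  have left := sum_toReal_arg_sub (z := fun j => cornerPath u v w (j / (m + m : ℕ))) (c := u - v)
    (m := m) fun j hj => re_cornerPath_div_left hu hv huv w (by
      rw [← e1]
      gcongr)
  have right := sum_toReal_arg_sub (z := fun j => cornerPath u v w ((m + j : ℕ) / (m + m : ℕ)))
    (c := u - w) (m := m) fun j hj => re_cornerPath_div_right hu hw huw v (by
      rw [← e1]
      gcongr
      omega)
  simp only [e0, e1, e2, cornerPath_zero, cornerPath_half, cornerPath_one, add_zero] at left right
  rw [sum_range_add, left, ← right]
  rfl

theorem toReal_half_turn_sub {d : ℤ} (hd : d % 7 ≠ 0) :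
    ((2 * Real.pi * (d / 7 - 1 / 2) : ℝ) : Real.Angle).toReal =
      2 * Real.pi * ((d % 7 : ℤ) / 7 - 1 / 2) := by
  have h1 : (0 : ℝ) < (d % 7 : ℤ) := by
    exact_mod_cast lt_of_le_of_ne (Int.emod_nonneg d (by norm_num)) (Ne.symm hd)
  have h2 : ((d % 7 : ℤ) : ℝ) < 7 := by exact_mod_cast Int.emod_lt_of_pos d (by norm_num)
  have hpi := Real.pi_pos
  have e : ((2 * Real.pi * (d / 7 - 1 / 2) : ℝ) : Real.Angle) =
      ((2 * Real.pi * ((d % 7 : ℤ) / 7 - 1 / 2) : ℝ) : Real.Angle) := by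
    rw [Real.Angle.angle_eq_iff_two_pi_dvd_sub]
    refine ⟨d / 7, ?_⟩
    have : (d : ℝ) = (d % 7 : ℤ) + 7 * (d / 7 : ℤ) := by exact_mod_cast (Int.emod_add_mul_ediv d 7).symm
    rw [this]
    ring
  rw [e, Real.Angle.toReal_coe_eq_self_iff]
  constructor <;> nlinarith

theorem arg_neg_expTurn (x : ℝ) :
    ((-expTurn x).arg : Real.Angle) = ((2 * Real.pi * (x - 1 / 2) : ℝ) : Real.Angle) := by
  have : -expTurn x = expTurn (x - 1 / 2) := by
    have h : expTurn (-(1 / 2)) = -1 := by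
      rw [expTurn, show ((2 * Real.pi * -(1 / 2) : ℝ) : ℂ) * Complex.I = -(Real.pi * Complex.I) by
        push_cast; ring, Complex.exp_neg, Complex.exp_pi_mul_I]
      norm_num
    rw [sub_eq_add_neg, expTurn_add, h, mul_neg_one]
  rw [this, arg_expTurn]

theorem expTurn_div_seven_ne {a b : ℤ} (h : (a - b) % 7 ≠ 0) : expTurn (a / 7) ≠ expTurn (b / 7) := by
  intro he
  have h1 := congrArg (fun z : ℂ => (z.arg : Real.Angle)) he
  simp only [arg_expTurn] at h1
  obtain ⟨k, hk⟩ := Real.Angle.angle_eq_iff_two_pi_dvd_sub.1 h1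
  have hpi : (2 * Real.pi) ≠ 0 := by positivity
  have h2 : (a : ℝ) - b = 7 * k := by
    apply mul_left_cancel₀ hpi
    linear_combination 7 * hk
  have h3 : a - b = 7 * k := by exact_mod_cast h2
  omega

/-- The total turning of a corner path between seventh roots of unity. -/
theorem sum_toReal_arg_cornerPath_expTurn {a b c : ℤ} (hab : (a - b) % 7 ≠ 0) (hca : (c - a) % 7 ≠ 0)
    {m : ℕ} (hm : 0 < m) :
    ∑ j ∈ range (m + m),
      (((cornerPath (expTurn (a / 7)) (expTurn (b / 7)) (expTurn (c / 7))
        ((j + 1 : ℕ) / (m + m : ℕ))).arg : Real.Angle) -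
      (cornerPath (expTurn (a / 7)) (expTurn (b / 7)) (expTurn (c / 7))
        (j / (m + m : ℕ))).arg).toReal =
    2 * Real.pi * ((((a - b) % 7 : ℤ) + ((c - a) % 7 : ℤ)) / 7 - 1) := by
  rw [sum_toReal_arg_cornerPath (norm_expTurn _) (norm_expTurn _) (norm_expTurn _)
    (expTurn_div_seven_ne hab) (expTurn_div_seven_ne hca).symm hm, arg_neg_expTurn, arg_neg_expTurn,
    arg_expTurn, ← Real.Angle.coe_sub, ← Real.Angle.coe_sub]
  have e1 : ((2 * Real.pi * (a / 7) - 2 * Real.pi * (b / 7 - 1 / 2) : ℝ) : Real.Angle) =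
      ((2 * Real.pi * (((a - b : ℤ) : ℝ) / 7 - 1 / 2) : ℝ) : Real.Angle) := by
    rw [Real.Angle.angle_eq_iff_two_pi_dvd_sub]
    exact ⟨1, by push_cast; ring⟩
  have e2 : 2 * Real.pi * (c / 7 - 1 / 2) - 2 * Real.pi * (a / 7) =
      2 * Real.pi * (((c - a : ℤ) : ℝ) / 7 - 1 / 2) := by
    push_cast
    ring
  rw [e1, e2, toReal_half_turn_sub hab, toReal_half_turn_sub hca]
  ring

end AngleGrid

theorem norm_sq_coords (x : SphereC2) : ‖(x : EuclideanSpace ℂ (Fin 2)) 0‖ ^ 2 +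
    ‖(x : EuclideanSpace ℂ (Fin 2)) 1‖ ^ 2 = 1 := by
  have h := EuclideanSpace.norm_sq_eq (x : EuclideanSpace ℂ (Fin 2))
  rw [mem_sphere_zero_iff_norm.1 x.2, Fin.sum_univ_two] at h
  linarith

theorem sphere_ext {x y : SphereC2}
    (h0 : (x : EuclideanSpace ℂ (Fin 2)) 0 = (y : EuclideanSpace ℂ (Fin 2)) 0)
    (h1 : (x : EuclideanSpace ℂ (Fin 2)) 1 = (y : EuclideanSpace ℂ (Fin 2)) 1) : x = y := by
  ext i
  fin_cases i
  · exact h0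
  · exact h1

/-- The point of `S³` with the given coordinates. -/
def sphereMk (z w : ℂ) (h : ‖z‖ ^ 2 + ‖w‖ ^ 2 = 1) : SphereC2 :=
  ⟨!₂[z, w], by simp [EuclideanSpace.norm_eq, Fin.sum_univ_two, h]⟩

/-- A disc in `S³` bounded by a great circle, in polar coordinates. -/
noncomputable def discPoint (σ φ : ℝ) : SphereC2 :=
  sphereMk (expTurn φ * (Set.projIcc (0 : ℝ) 1 zero_le_one σ : ℝ))
    (√(1 - (Set.projIcc (0 : ℝ) 1 zero_le_one σ : ℝ) ^ 2) : ℝ) (by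
      obtain ⟨h0, h1⟩ := (Set.projIcc (0 : ℝ) 1 zero_le_one σ).2
      rw [norm_mul, norm_expTurn, one_mul, Complex.norm_real, Complex.norm_real, Real.norm_eq_abs,
        Real.norm_eq_abs, sq_abs, sq_abs, Real.sq_sqrt (by nlinarith)]
      ring)

theorem discPoint_fst {σ : ℝ} (hσ : σ ∈ Set.Icc (0 : ℝ) 1) (φ : ℝ) :
    (discPoint σ φ : EuclideanSpace ℂ (Fin 2)) 0 = expTurn φ * σ := by
  simp [discPoint, sphereMk, Set.projIcc_of_mem zero_le_one hσ]

theorem discPoint_snd {σ : ℝ} (hσ : σ ∈ Set.Icc (0 : ℝ) 1) (φ : ℝ) :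
    (discPoint σ φ : EuclideanSpace ℂ (Fin 2)) 1 = (√(1 - σ ^ 2) : ℝ) := by
  simp [discPoint, sphereMk, Set.projIcc_of_mem zero_le_one hσ]

theorem continuous_discPoint : Continuous fun x : ℝ × ℝ => discPoint x.1 x.2 := by
  refine Continuous.subtype_mk ?_ _
  refine (PiLp.continuous_toLp 2 _).comp (continuous_pi fun i => ?_)
  have hp : Continuous fun x : ℝ × ℝ => (Set.projIcc (0 : ℝ) 1 zero_le_one x.1 : ℝ) :=
    continuous_subtype_val.comp (continuous_projIcc.comp continuous_fst)
  fin_cases i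
  · simp only [Fin.zero_eta, Matrix.cons_val_zero]
    fun_prop
  · simp only [Fin.mk_one, Matrix.cons_val_one]
    fun_prop

theorem discPoint_center (φ : ℝ) : discPoint 0 φ = discPoint 0 0 := by
  have h : (0 : ℝ) ∈ Set.Icc (0 : ℝ) 1 := by simp
  apply sphere_ext
  · simp [discPoint_fst h]
  · simp [discPoint_snd h]

theorem discPoint_periodic (σ φ : ℝ) : discPoint σ (φ + 1) = discPoint σ φ := by
  simp [discPoint, expTurn_add]

theorem coords_eq_of_smul_eq {x y : SphereC2} {u v : ℂ} (hu : ‖u‖ = 1) (hv : ‖v‖ = 1) {p q : ℝ}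
    (hp : 0 ≤ p) (hq : 0 ≤ q) (hpq : 0 < p + q)
    (h0 : p * (y : EuclideanSpace ℂ (Fin 2)) 0 - q * (u * (x : EuclideanSpace ℂ (Fin 2)) 0) = 0)
    (h1 : p * (y : EuclideanSpace ℂ (Fin 2)) 1 - q * (v * (x : EuclideanSpace ℂ (Fin 2)) 1) = 0) :
    (y : EuclideanSpace ℂ (Fin 2)) 0 = u * (x : EuclideanSpace ℂ (Fin 2)) 0 ∧
      (y : EuclideanSpace ℂ (Fin 2)) 1 = v * (x : EuclideanSpace ℂ (Fin 2)) 1 := by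
  have n0 := congrArg (‖·‖ ^ 2) (sub_eq_zero.1 h0)
  have n1 := congrArg (‖·‖ ^ 2) (sub_eq_zero.1 h1)
  simp only [norm_mul, hu, hv, Complex.norm_real, Real.norm_of_nonneg hp, Real.norm_of_nonneg hq,
    one_mul, mul_pow] at n0 n1
  have hsq : p ^ 2 = q ^ 2 := by
    linear_combination n0 + n1 - p ^ 2 * norm_sq_coords y + q ^ 2 * norm_sq_coords x
  have hpq' : p = q := by
    rcases sq_eq_sq_iff_eq_or_eq_neg.1 hsq with h | h <;> linarith
  have hp0 : (p : ℂ) ≠ 0 := by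
    norm_cast
    intro h
    linarith
  subst hpq'
  rw [← mul_sub, mul_eq_zero, or_iff_right hp0, sub_eq_zero] at h0 h1
  exact ⟨h0, h1⟩

theorem exists_corner_indices : ∀ c : Fin 7, c ≠ 0 → ∃ k j : Fin 7, k ≠ 0 ∧ k ≠ c ∧ j ≠ 0 ∧ j ≠ c ∧
    ¬ (49 : ℤ) ∣ 2 * (((c : ℤ) - (k : ℤ)) % 7 + ((j : ℤ) - (c : ℤ)) % 7) +
      ((2 * (c : ℤ) - 2 * (k : ℤ)) % 7 + (2 * (j : ℤ) - 2 * (c : ℤ)) % 7) -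
      (2 * ((0 - (k : ℤ)) % 7 + ((j : ℤ) - 0) % 7) + ((2 * 0 - 2 * (k : ℤ)) % 7 + (2 * (j : ℤ) - 2 * 0) % 7)) := by
  decide

open AngleGrid in
/-- There is no deck-equivariant isotopy-like homotopy from the identity to a nontrivial deck
transformation of `S³ → L(7,2)` that avoids all the other deck transformations. -/
theorem no_avoiding_homotopy (H : unitInterval → SphereC2 → SphereC2)
    (hH : Continuous fun x : unitInterval × SphereC2 => H x.1 x.2) (c : Fin 7) (hc : c ≠ 0)
    (start : ∀ x, H 0 x = x)
    (finish_fst : ∀ x, (H 1 x : EuclideanSpace ℂ (Fin 2)) 0 =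
      expTurn ((c : ℤ) / 7) * (x : EuclideanSpace ℂ (Fin 2)) 0)
    (finish_snd : ∀ x, (H 1 x : EuclideanSpace ℂ (Fin 2)) 1 =
      expTurn ((2 * (c : ℤ) : ℤ) / 7) * (x : EuclideanSpace ℂ (Fin 2)) 1)
    (equivariant : ∀ (t : unitInterval) (x y : SphereC2),
      (y : EuclideanSpace ℂ (Fin 2)) 0 = (x : EuclideanSpace ℂ (Fin 2)) 0 * expTurn (1 / 7) →
      (y : EuclideanSpace ℂ (Fin 2)) 1 = (x : EuclideanSpace ℂ (Fin 2)) 1 * expTurn (2 / 7) →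
      (H t y : EuclideanSpace ℂ (Fin 2)) 0 = (H t x : EuclideanSpace ℂ (Fin 2)) 0 * expTurn (1 / 7) ∧
      (H t y : EuclideanSpace ℂ (Fin 2)) 1 = (H t x : EuclideanSpace ℂ (Fin 2)) 1 * expTurn (2 / 7))
    (avoid : ∀ t x (k : Fin 7), k ≠ 0 → k ≠ c → ¬
      ((H t x : EuclideanSpace ℂ (Fin 2)) 0 = expTurn ((k : ℤ) / 7) * (x : EuclideanSpace ℂ (Fin 2)) 0 ∧
      (H t x : EuclideanSpace ℂ (Fin 2)) 1 =
        expTurn ((2 * (k : ℤ) : ℤ) / 7) * (x : EuclideanSpace ℂ (Fin 2)) 1)) : False := by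
  obtain ⟨k, j, hk0, hkc, hj0, hjc, hkj⟩ := exists_corner_indices c hc
  let T : ℝ → unitInterval := Set.projIcc (0 : ℝ) 1 zero_le_one
  have T0 : T 0 = 0 := Set.projIcc_left _
  have T1 : T 1 = 1 := Set.projIcc_right _
  let W (w : ℤ) (i : Fin 2) : ℝ × ℝ × ℝ × ℝ → ℂ := fun x =>
    tent x.2.1 * (H (T x.1) (discPoint x.2.2.1 x.2.2.2) : EuclideanSpace ℂ (Fin 2)) i
      - cutLeft x.2.1 * (expTurn ((w * (k : ℤ) : ℤ) / 7) *
        (discPoint x.2.2.1 x.2.2.2 : EuclideanSpace ℂ (Fin 2)) i)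
      - cutRight x.2.1 * (expTurn ((w * (j : ℤ) : ℤ) / 7) *
        (discPoint x.2.2.1 x.2.2.2 : EuclideanSpace ℂ (Fin 2)) i)
  have contW : ∀ w i, Continuous (W w i) := fun w i => by
    have hd : Continuous fun x : ℝ × ℝ × ℝ × ℝ => discPoint x.2.2.1 x.2.2.2 :=
      continuous_discPoint.comp (by fun_prop)
    have hd' : Continuous fun x : ℝ × ℝ × ℝ × ℝ =>
        (discPoint x.2.2.1 x.2.2.2 : EuclideanSpace ℂ (Fin 2)) i :=
      (EuclideanSpace.proj (𝕜 := ℂ) i).continuous.comp (continuous_subtype_val.comp hd)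
    have hT : Continuous fun x : ℝ × ℝ × ℝ × ℝ => T x.1 :=
      (continuous_projIcc (h := zero_le_one)).comp continuous_fst
    have hh : Continuous fun x : ℝ × ℝ × ℝ × ℝ =>
        (H (T x.1) (discPoint x.2.2.1 x.2.2.2) : EuclideanSpace ℂ (Fin 2)) i :=
      (EuclideanSpace.proj (𝕜 := ℂ) i).continuous.comp (continuous_subtype_val.comp
        (hH.comp (hT.prodMk hd)))
    have hs : ∀ r : ℝ → ℝ, Continuous r → Continuous fun x : ℝ × ℝ × ℝ × ℝ => (r x.2.1 : ℂ) :=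
      fun r hr => by fun_prop
    exact (((hs _ continuous_tent).mul hh).sub ((hs _ continuous_cutLeft).mul
      (continuous_const.mul hd'))).sub ((hs _ continuous_cutRight).mul (continuous_const.mul hd'))
  let a (w : ℤ) (t : ℝ) : ℝ → ℂ := cornerPath (expTurn ((w * (if t = 0 then 0 else (c : ℤ)) : ℤ) / 7))
    (expTurn ((w * (k : ℤ) : ℤ) / 7)) (expTurn ((w * (j : ℤ) : ℤ) / 7))
  have side : ∀ w i t s σ φ, t = 0 ∨ t = 1 → (∀ x, (H 1 x : EuclideanSpace ℂ (Fin 2)) i =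
      expTurn ((w * (c : ℤ) : ℤ) / 7) * (x : EuclideanSpace ℂ (Fin 2)) i) →
      W w i (t, s, σ, φ) = a w t s * (discPoint σ φ : EuclideanSpace ℂ (Fin 2)) i := by
    rintro w i t s σ φ (rfl | rfl) hw
    · simp only [W, a, T0, start, cornerPath, if_true]
      simp only [mul_zero, Int.cast_zero, zero_div, expTurn_zero]
      ring
    · simp only [W, a, T1, hw, cornerPath, one_ne_zero, if_false]
      ring
  have diff : ∀ p q : Fin 7, p ≠ q → ((p : ℤ) - (q : ℤ)) % 7 ≠ 0 ∧
      (2 * (p : ℤ) - 2 * (q : ℤ)) % 7 ≠ 0 := by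
    decide
  have neq : ∀ w : ℤ, w = 1 ∨ w = 2 → ∀ p q : Fin 7, p ≠ q →
      ((w * (p : ℤ) - w * (q : ℤ)) % 7 ≠ 0) := by
    rintro w (rfl | rfl) p q h
    · simpa using (diff p q h).1
    · exact (diff p q h).2
  have family : DiscFamily (W 1 0) (W 2 1) (a 1) (a 2) := by
    have one_mem : (1 : ℝ) ∈ Set.Icc (0 : ℝ) 1 := by simp
    have tent_ends : ∀ s, s = 0 ∨ s = 1 → tent s = 0 := by
      rintro s (rfl | rfl) <;> norm_num [tent]
    constructor
    · intro t s σ φ ht hσ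
      rw [side 1 0 t s σ φ ht (by simpa using finish_fst), discPoint_fst hσ, mul_assoc]
    · intro t s σ φ ht hσ
      rw [side 2 1 t s σ φ ht (by simpa using finish_snd), discPoint_snd hσ]
    · rintro t s ht
      rcases ht with rfl | rfl
      · simp only [a, if_true]
        exact cornerPath_ne_zero (norm_expTurn _) (norm_expTurn _) (norm_expTurn _)
          (expTurn_div_seven_ne (neq 1 (Or.inl rfl) 0 k hk0.symm))
          (expTurn_div_seven_ne (neq 1 (Or.inl rfl) 0 j hj0.symm)) _
      · simp only [a, one_ne_zero, if_false]
        exact cornerPath_ne_zero (norm_expTurn _) (norm_expTurn _) (norm_expTurn _)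
          (expTurn_div_seven_ne (neq 1 (Or.inl rfl) c k hkc.symm))
          (expTurn_div_seven_ne (neq 1 (Or.inl rfl) c j hjc.symm)) _
    · intro t s σ φ hs
      simp only [W, tent_ends s hs, Complex.ofReal_zero, zero_mul]
    · intro t s σ φ hs
      simp only [W, tent_ends s hs, Complex.ofReal_zero, zero_mul]
    · intro t s φ
      simp only [W, discPoint_center φ]
    · intro t s φ
      simp only [W, discPoint_center φ]
    · intro t s φ
      have e0 : (discPoint 1 (φ + 1 / 7) : EuclideanSpace ℂ (Fin 2)) 0 =
          (discPoint 1 φ : EuclideanSpace ℂ (Fin 2)) 0 * expTurn (1 / 7) := by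
        simp [discPoint_fst one_mem, expTurn_add]
      have e1 : (discPoint 1 (φ + 1 / 7) : EuclideanSpace ℂ (Fin 2)) 1 =
          (discPoint 1 φ : EuclideanSpace ℂ (Fin 2)) 1 * expTurn (2 / 7) := by
        simp [discPoint_snd one_mem]
      simp only [W, (equivariant (T t) _ _ e0 e1).1, e0]
      ring
    · intro t s φ
      have e0 : (discPoint 1 (φ + 1 / 7) : EuclideanSpace ℂ (Fin 2)) 0 =
          (discPoint 1 φ : EuclideanSpace ℂ (Fin 2)) 0 * expTurn (1 / 7) := by
        simp [discPoint_fst one_mem, expTurn_add]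
      have e1 : (discPoint 1 (φ + 1 / 7) : EuclideanSpace ℂ (Fin 2)) 1 =
          (discPoint 1 φ : EuclideanSpace ℂ (Fin 2)) 1 * expTurn (2 / 7) := by
        simp [discPoint_snd one_mem]
      simp only [W, (equivariant (T t) _ _ e0 e1).2, e1]
      ring
    · intro t s σ φ
      simp only [W, discPoint_periodic]
    · intro t s σ φ
      simp only [W, discPoint_periodic]
  have nonzero : ∀ x ∈ Set.Icc (0 : ℝ × ℝ × ℝ × ℝ) 1, W 1 0 x ≠ 0 ∨ W 2 1 x ≠ 0 := by
    rintro ⟨t, s, σ, φ⟩ -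
    by_contra! h
    obtain ⟨h0, h1⟩ := h
    rcases le_total s (1 / 2) with hs | hs
    · simp only [W, cutRight_eq_zero hs, Complex.ofReal_zero, zero_mul, sub_zero] at h0 h1
      have := coords_eq_of_smul_eq (norm_expTurn _) (norm_expTurn _) (tent_nonneg s)
        (cutLeft_nonneg s) (tent_add_cutLeft_pos hs) h0 h1
      exact avoid _ _ k hk0 hkc (by simpa only [one_mul] using this)
    · simp only [W, cutLeft_eq_zero hs, Complex.ofReal_zero, zero_mul, sub_zero] at h0 h1
      have := coords_eq_of_smul_eq (norm_expTurn _) (norm_expTurn _) (tent_nonneg s)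
        (cutRight_nonneg s) (tent_add_cutRight_pos hs) h0 h1
      exact avoid _ _ j hj0 hjc (by simpa only [one_mul] using this)
  obtain ⟨n₀, hn₀⟩ := Filter.eventually_atTop.1
    (family.seven_dvd_turning (contW 1 0) (contW 2 1) nonzero)
  obtain ⟨m, hm⟩ := hn₀ ((n₀ + 1) + (n₀ + 1)) (by omega)
  have zero_eq : ∀ w : ℤ, w * 0 = w * ((0 : Fin 7) : ℤ) := fun w => by simp
  have turn : ∀ w : ℤ, w = 1 ∨ w = 2 → ∀ p : Fin 7, p ≠ k → p ≠ j →
      ∑ i ∈ range ((n₀ + 1) + (n₀ + 1)),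
        (((cornerPath (expTurn ((w * (p : ℤ) : ℤ) / 7)) (expTurn ((w * (k : ℤ) : ℤ) / 7))
          (expTurn ((w * (j : ℤ) : ℤ) / 7))
          ((i + 1 : ℕ) / ((n₀ + 1) + (n₀ + 1) : ℕ))).arg : Real.Angle) -
        (cornerPath (expTurn ((w * (p : ℤ) : ℤ) / 7)) (expTurn ((w * (k : ℤ) : ℤ) / 7))
          (expTurn ((w * (j : ℤ) : ℤ) / 7)) (i / ((n₀ + 1) + (n₀ + 1) : ℕ))).arg).toReal =
      2 * Real.pi * ((((w * (p : ℤ) - w * (k : ℤ)) % 7 : ℤ) +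
        ((w * (j : ℤ) - w * (p : ℤ)) % 7 : ℤ)) / 7 - 1) := fun w hw p hpk hpj =>
    sum_toReal_arg_cornerPath_expTurn (neq w hw p k hpk) (neq w hw j p hpj.symm) n₀.succ_pos
  simp only [a, one_ne_zero, if_true, if_false, sum_add_distrib, ← mul_sum] at hm
  rw [turn 1 (Or.inl rfl) c hkc.symm hjc.symm, turn 2 (Or.inr rfl) c hkc.symm hjc.symm,
    zero_eq 1, zero_eq 2, turn 1 (Or.inl rfl) 0 hk0.symm hj0.symm,
    turn 2 (Or.inr rfl) 0 hk0.symm hj0.symm] at hm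
  apply hkj
  refine ⟨m, ?_⟩
  have hpi : (2 * Real.pi) ≠ 0 := by positivity
  have : ((2 * (((c : ℤ) - (k : ℤ)) % 7 + ((j : ℤ) - (c : ℤ)) % 7) +
      ((2 * (c : ℤ) - 2 * (k : ℤ)) % 7 + (2 * (j : ℤ) - 2 * (c : ℤ)) % 7) -
      (2 * ((0 - (k : ℤ)) % 7 + ((j : ℤ) - 0) % 7) +
        ((2 * 0 - 2 * (k : ℤ)) % 7 + (2 * (j : ℤ) - 2 * 0) % 7)) : ℤ) : ℝ) = (49 * m : ℤ) := by
    apply mul_left_cancel₀ hpi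
    simp only [one_mul, Fin.val_zero, Nat.cast_zero] at hm
    push_cast
    push_cast at hm
    linear_combination 7 * hm
  exact_mod_cast this

end GridDegree

section SimplyConnectedSphere

open Metric Module

variable {E : Type*} [NormedAddCommGroup E]

theorem exists_path_homotopic_forall_eq_smul [NormedSpace ℝ E] {x y : sphere (0 : E) 1}
    (γ : Path x y) (P : C(unitInterval, E)) (hP0 : P 0 = x) (hP1 : P 1 = y)
    (hP : ∀ t, ‖P t - γ t‖ < 1) :
    ∃ q : Path x y, γ.Homotopic q ∧ ∀ t, ∃ r : ℝ, (q t : E) = r • P t := by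
  let V : unitInterval × unitInterval → E := fun z => (γ z.2 : E) + (z.1 : ℝ) • (P z.2 - γ z.2)
  have contV : Continuous V := by fun_prop
  have normγ : ∀ t, ‖(γ t : E)‖ = 1 := fun t => norm_eq_of_mem_sphere (γ t)
  have hV : ∀ z, V z ≠ 0 := fun z hz => by
    have h1 : (γ z.2 : E) = -((z.1 : ℝ) • (P z.2 - γ z.2)) := eq_neg_of_add_eq_zero_left hz
    have h2 : ‖(z.1 : ℝ) • (P z.2 - γ z.2)‖ < 1 := by
      rw [norm_smul, Real.norm_of_nonneg z.1.2.1]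
      exact (mul_le_of_le_one_left (norm_nonneg _) z.1.2.2).trans_lt (hP _)
    rw [← norm_neg, ← h1, normγ] at h2
    exact h2.false
  let F : unitInterval × unitInterval → sphere (0 : E) 1 := fun z =>
    ⟨‖V z‖⁻¹ • V z, by simp [norm_smul, hV z]⟩
  have contF : Continuous F := Continuous.subtype_mk
    ((contV.norm.inv₀ fun z => norm_ne_zero_iff.2 (hV z)).smul contV) _
  have F_left : ∀ t, F (0, t) = γ t := fun t => Subtype.ext (by simp [F, V, normγ])
  have F_src : ∀ s, F (s, 0) = x := fun s => Subtype.ext (by simp [F, V, hP0])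
  have F_tgt : ∀ s, F (s, 1) = y := fun s => Subtype.ext (by simp [F, V, hP1])
  refine ⟨⟨⟨fun t => F (1, t), by fun_prop⟩, F_src 1, F_tgt 1⟩, ⟨⟨⟨⟨F, contF⟩, F_left,
    fun t => rfl⟩, ?_⟩⟩, fun t => ⟨‖V (1, t)‖⁻¹, ?_⟩⟩
  · rintro s t (rfl | rfl)
    · simp [F_src]
    · simp [F_tgt]
  · have hV1 : V (1, t) = P t := by simp [V]
    change ‖V (1, t)‖⁻¹ • V (1, t) = _
    rw [hV1]

theorem exists_contDiff_forall_norm_sub_lt [NormedSpace ℝ E] (f : C(unitInterval, E)) {ε : ℝ}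
    (hε : 0 < ε) : ∃ P : ℝ → E, ContDiff ℝ 1 P ∧ P 0 = f 0 ∧ P 1 = f 1 ∧
      ∀ t : unitInterval, ‖P t - f t‖ < ε := by
  obtain ⟨n, hn, hn0⟩ := (((Metric.tendsto_nhds.1 (bernsteinApproximation_uniform f)) ε hε).and
    (Filter.eventually_ne_atTop 0)).exists
  let P : ℝ → E := fun t =>
    ∑ k : Fin (n + 1), ((bernsteinPolynomial ℝ n k).eval t) • f (bernstein.z k)
  have hP : ∀ t : unitInterval, P t = bernsteinApproximation n f t := fun t => by
    simp only [P, bernsteinApproximation.apply]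
    rfl
  refine ⟨P, ?_, ?_, ?_, fun t => ?_⟩
  · have hb : ∀ p : Polynomial ℝ, ContDiff ℝ 1 fun t => p.eval t := fun p => by
      simpa using p.contDiff_aeval (𝕜 := ℝ) 1
    exact ContDiff.sum fun k _ => (hb _).smul contDiff_const
  · simpa using hP 0
  · simpa [hn0] using hP 1
  · rw [hP, ← dist_eq_norm]
    exact (ContinuousMap.dist_apply_le_dist t).trans_lt hn

variable [InnerProductSpace ℝ E]

theorem contractibleSpace_compl_singleton_sphere (v : sphere (0 : E) 1) :
    ContractibleSpace ({v}ᶜ : Set (sphere (0 : E) 1)) :=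
  let e := (stereographic (norm_eq_of_mem_sphere v)).toHomeomorphSourceTarget
  (e.trans (Homeomorph.Set.univ _)).contractibleSpace

theorem simplyConnectedSpace_sphere [FiniteDimensional ℝ E] (h : 2 < finrank ℝ E) :
    SimplyConnectedSpace (sphere (0 : E) 1) := by
  rw [simply_connected_iff_loops_nullhomotopic]
  have hrank : 1 < Module.rank ℝ E := by
    rw [← finrank_eq_rank]
    exact_mod_cast (by omega : 1 < finrank ℝ E)
  refine ⟨isPathConnected_iff_pathConnectedSpace.1 (isPathConnected_sphere hrank 0 zero_le_one),
    fun x γ => ?_⟩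
  obtain ⟨P, hP, hP0, hP1, hPγ⟩ := exists_contDiff_forall_norm_sub_lt
    ((⟨Subtype.val, continuous_subtype_val⟩ : C(sphere (0 : E) 1, E)).comp γ) one_pos
  have hPγ' : ∀ t : unitInterval, ‖P t - γ t‖ < 1 := hPγ
  obtain ⟨q, hγq, hq⟩ := exists_path_homotopic_forall_eq_smul γ
    ⟨fun t => P t, hP.continuous.comp continuous_subtype_val⟩ (by simpa using hP0)
    (by simpa using hP1) hPγ'
  have cone : ContDiff ℝ 1 fun z : ℝ × ℝ => z.1 • P z.2 := contDiff_fst.smul (hP.comp contDiff_snd)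
  obtain ⟨w, hw⟩ := (cone.dense_compl_range_of_finrank_lt_finrank (by simpa using h)).nonempty
  have hw0 : w ≠ 0 := fun h0 => hw ⟨(0, 0), by simp [h0]⟩
  let v : sphere (0 : E) 1 := ⟨‖w‖⁻¹ • w, by simp [norm_smul, hw0]⟩
  have hqv : ∀ t, q t ∈ ({v}ᶜ : Set (sphere (0 : E) 1)) := fun t ht => by
    obtain ⟨r, hr⟩ := hq t
    apply hw
    refine ⟨(‖w‖ * r, t), ?_⟩
    have hv : r • P t = ‖w‖⁻¹ • w := hr.symm.trans (congrArg Subtype.val ht)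
    simp [mul_smul, hv, hw0]
  have := contractibleSpace_compl_singleton_sphere v
  obtain ⟨F, -⟩ := (isSimplyConnected_iff_exists_homotopy_refl_forall_mem.1
    (show IsSimplyConnected ({v}ᶜ : Set (sphere (0 : E) 1)) from
      SimplyConnectedSpace.ofContractible _)).2 x q hqv
  exact hγq.trans ⟨F⟩

end SimplyConnectedSphere

theorem simplyConnectedSpace_sphereC2 : SimplyConnectedSpace SphereC2 := by
  let _ : InnerProductSpace ℝ (EuclideanSpace ℂ (Fin 2)) := InnerProductSpace.rclikeToReal ℂ _
  have h : Module.finrank ℝ (EuclideanSpace ℂ (Fin 2)) = 4 := by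
    rw [finrank_real_of_complex, finrank_euclideanSpace_fin]
  exact simplyConnectedSpace_sphere (by omega)

theorem locallyPathConnectedSpace_sphereC2 : LocallyPathConnectedSpace SphereC2 := by
  let _ : InnerProductSpace ℝ (EuclideanSpace ℂ (Fin 2)) := InnerProductSpace.rclikeToReal ℂ _
  have : Fact (Module.finrank ℝ (EuclideanSpace ℂ (Fin 2)) = 3 + 1) := ⟨by
    rw [finrank_real_of_complex, finrank_euclideanSpace_fin]⟩
  exact ChartedSpace.locallyPathConnectedSpace (EuclideanSpace ℝ (Fin 3)) SphereC2

theorem zeta7_pow (n : ℕ) : zeta7 ^ n = expTurn (n / 7) := by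
  rw [zeta7, expTurn, ← Complex.exp_nat_mul]
  congr 1
  push_cast
  ring

theorem isPrimitiveRoot_zeta7 : IsPrimitiveRoot zeta7 7 :=
  Complex.isPrimitiveRoot_exp 7 (by norm_num)

theorem zeta7_pow_mod (n : ℕ) : zeta7 ^ (n % 7) = zeta7 ^ n := by
  rw [← pow_mod_orderOf zeta7 n, ← isPrimitiveRoot_zeta7.eq_orderOf]

theorem modEq_of_zeta7_pow_mul_eq {m n : ℕ} {z : ℂ} (hz : z ≠ 0)
    (h : zeta7 ^ m * z = zeta7 ^ n * z) : m ≡ n [MOD 7] := by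
  have := mul_right_cancel₀ hz h
  rw [← zeta7_pow_mod m, ← zeta7_pow_mod n] at this
  exact isPrimitiveRoot_zeta7.pow_inj (Nat.mod_lt _ (by norm_num)) (Nat.mod_lt _ (by norm_num)) this

/-- The rotation of `S³` by `a` and `b` turns in the two coordinates. -/
noncomputable def rotate (a b : ℝ) (x : SphereC2) : SphereC2 :=
  sphereMk (expTurn a * (x : EuclideanSpace ℂ (Fin 2)) 0)
    (expTurn b * (x : EuclideanSpace ℂ (Fin 2)) 1) (by simp [norm_sq_coords])

@[simp] theorem rotate_fst (a b : ℝ) (x : SphereC2) : (rotate a b x : EuclideanSpace ℂ (Fin 2)) 0 =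
    expTurn a * (x : EuclideanSpace ℂ (Fin 2)) 0 := rfl

@[simp] theorem rotate_snd (a b : ℝ) (x : SphereC2) : (rotate a b x : EuclideanSpace ℂ (Fin 2)) 1 =
    expTurn b * (x : EuclideanSpace ℂ (Fin 2)) 1 := rfl

@[simp] theorem rotate_zero (x : SphereC2) : rotate 0 0 x = x := by
  apply sphere_ext <;> simp

theorem rotate_rotate (a b a' b' : ℝ) (x : SphereC2) :
    rotate a b (rotate a' b' x) = rotate (a + a') (b + b') x := by
  apply sphere_ext <;> simp [expTurn_add, mul_assoc]

theorem continuous_rotate : Continuous fun x : ℝ × ℝ × SphereC2 => rotate x.1 x.2.1 x.2.2 := by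
  refine Continuous.subtype_mk ?_ _
  refine (PiLp.continuous_toLp 2 _).comp (continuous_pi fun i => ?_)
  fin_cases i
  · simp only [Fin.zero_eta, Matrix.cons_val_zero]
    fun_prop
  · simp only [Fin.mk_one, Matrix.cons_val_one]
    fun_prop

/-- The `n`-th iterate of the generator of the deck group of `S³ → L(7,q)`. -/
noncomputable def deckMap (q n : ℕ) : SphereC2 → SphereC2 := rotate (n / 7) ((q * n : ℕ) / 7)

theorem deckMap_fst (q n : ℕ) (x : SphereC2) : (deckMap q n x : EuclideanSpace ℂ (Fin 2)) 0 =
    zeta7 ^ n * (x : EuclideanSpace ℂ (Fin 2)) 0 := by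
  rw [zeta7_pow, deckMap, rotate_fst]

theorem deckMap_snd (q n : ℕ) (x : SphereC2) : (deckMap q n x : EuclideanSpace ℂ (Fin 2)) 1 =
    zeta7 ^ (q * n) * (x : EuclideanSpace ℂ (Fin 2)) 1 := by
  rw [zeta7_pow, deckMap, rotate_snd]

theorem deckMap_deckMap (q m n : ℕ) (x : SphereC2) :
    deckMap q m (deckMap q n x) = deckMap q (m + n) x := by
  apply sphere_ext <;> simp [deckMap_fst, deckMap_snd, mul_add, pow_add, mul_assoc]

theorem deckMap_mod (q n : ℕ) (x : SphereC2) : deckMap q (n % 7) x = deckMap q n x := by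
  apply sphere_ext
  · rw [deckMap_fst, deckMap_fst, zeta7_pow_mod]
  · rw [deckMap_snd, deckMap_snd, ← zeta7_pow_mod (q * n), ← zeta7_pow_mod (q * (n % 7)),
      Nat.mul_mod_mod]

theorem continuous_deckMap (q n : ℕ) : Continuous (deckMap q n) :=
  continuous_rotate.comp (continuous_const.prodMk (continuous_const.prodMk continuous_id))

theorem fst_ne_zero_or_snd_ne_zero (x : SphereC2) : (x : EuclideanSpace ℂ (Fin 2)) 0 ≠ 0 ∨
    (x : EuclideanSpace ℂ (Fin 2)) 1 ≠ 0 := by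
  by_contra! h
  have := norm_sq_coords x
  simp [h.1, h.2] at this

theorem deckMap_injective {q : ℕ} (hq : q.Coprime 7) {m n : ℕ} {x : SphereC2}
    (h : deckMap q m x = deckMap q n x) : m % 7 = n % 7 := by
  have h0 := congrArg (fun y : SphereC2 => (y : EuclideanSpace ℂ (Fin 2)) 0) h
  have h1 := congrArg (fun y : SphereC2 => (y : EuclideanSpace ℂ (Fin 2)) 1) h
  simp only [deckMap_fst, deckMap_snd] at h0 h1
  rcases fst_ne_zero_or_snd_ne_zero x with hx | hx
  · exact modEq_of_zeta7_pow_mul_eq hx h0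
  · exact Nat.ModEq.cancel_left_of_coprime (m := 7) hq.symm (modEq_of_zeta7_pow_mul_eq hx h1)

/-- The deck group of `S³ → L(7,q)`. -/
def LensDeck (_q : ℕ) := Multiplicative (ZMod 7)

instance (q : ℕ) : CommGroup (LensDeck q) := inferInstanceAs (CommGroup (Multiplicative (ZMod 7)))

instance (q : ℕ) : Finite (LensDeck q) := inferInstanceAs (Finite (Multiplicative (ZMod 7)))

noncomputable instance (q : ℕ) : MulAction (LensDeck q) SphereC2 where
  smul g := deckMap q (ZMod.val (n := 7) (Multiplicative.toAdd (α := ZMod 7) g))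
  one_smul x := by
    apply sphere_ext
    · exact (deckMap_fst q 0 x).trans (by simp)
    · exact (deckMap_snd q 0 x).trans (by simp)
  mul_smul g h x := by
    change deckMap q (ZMod.val (n := 7) (Multiplicative.toAdd (α := ZMod 7) g +
      Multiplicative.toAdd (α := ZMod 7) h)) x = deckMap q _ (deckMap q _ x)
    rw [ZMod.val_add, deckMap_mod, deckMap_deckMap]

instance (q : ℕ) : ContinuousConstSMul (LensDeck q) SphereC2 := ⟨fun _ => continuous_deckMap q _⟩

theorem lensRel7_iff (q : ℕ) (x y : SphereC2) : lensRel7 q x y ↔ ∃ n : ℕ, y = deckMap q n x := by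
  constructor
  · rintro ⟨k, h0, h1⟩
    exact ⟨k, sphere_ext (h0.trans (deckMap_fst q k x).symm) (h1.trans (deckMap_snd q k x).symm)⟩
  · rintro ⟨n, rfl⟩
    refine ⟨⟨n % 7, Nat.mod_lt _ (by norm_num)⟩, ?_, ?_⟩
    · rw [← deckMap_mod, deckMap_fst]
    · rw [← deckMap_mod, deckMap_snd]

/-- The projection `S³ → L(7,q)`. -/
def lensProj (q : ℕ) : SphereC2 → LensSpace7 q := Quot.mk (lensRel7 q)

theorem isQuotientMap_lensProj (q : ℕ) : Topology.IsQuotientMap (lensProj q) :=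
  isQuotientMap_quot_mk

theorem deckMap_add_six_mul (q n : ℕ) (x : SphereC2) : deckMap q (6 * n) (deckMap q n x) = x := by
  rw [deckMap_deckMap, ← deckMap_mod, show (6 * n + n) % 7 = 0 by omega]
  simp [deckMap]

theorem lensRel7_equivalence (q : ℕ) : Equivalence (lensRel7 q) where
  refl x := (lensRel7_iff q x x).2 ⟨0, by simp [deckMap]⟩
  symm {x y} h := by
    obtain ⟨n, rfl⟩ := (lensRel7_iff q x y).1 h
    exact (lensRel7_iff q _ _).2 ⟨6 * n, (deckMap_add_six_mul q n x).symm⟩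
  trans {x y z} h h' := by
    obtain ⟨n, rfl⟩ := (lensRel7_iff q x y).1 h
    obtain ⟨m, rfl⟩ := (lensRel7_iff q _ z).1 h'
    exact (lensRel7_iff q _ _).2 ⟨m + n, deckMap_deckMap q m n x⟩

theorem lensProj_eq_iff {q : ℕ} {x y : SphereC2} :
    lensProj q x = lensProj q y ↔ ∃ n : ℕ, y = deckMap q n x :=
  (lensRel7_equivalence q).quot_mk_eq_iff x y |>.trans (lensRel7_iff q x y)

theorem lensProj_deckMap (q n : ℕ) (x : SphereC2) : lensProj q (deckMap q n x) = lensProj q x :=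
  (lensProj_eq_iff.2 ⟨n, rfl⟩).symm

theorem isQuotientCoveringMap_lensProj {q : ℕ} (hq : q.Coprime 7) :
    IsQuotientCoveringMap (lensProj q) (LensDeck q) := by
  have : IsCancelSMul (LensDeck q) SphereC2 := ⟨fun g h x hgh => by
    have := deckMap_injective hq hgh
    rw [Nat.mod_eq_of_lt (ZMod.val_lt _), Nat.mod_eq_of_lt (ZMod.val_lt _)] at this
    exact ZMod.val_injective 7 this⟩
  refine (isQuotientMap_lensProj q).isQuotientCoveringMap_of_properlyDiscontinuousSMul ?_
  intro x y
  rw [eq_comm, lensProj_eq_iff]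
  constructor
  · rintro ⟨n, rfl⟩
    refine ⟨Multiplicative.ofAdd ((n : ℕ) : ZMod 7), ?_⟩
    change deckMap q (ZMod.val ((n : ℕ) : ZMod 7)) y = _
    rw [ZMod.val_natCast, deckMap_mod]
  · rintro ⟨g, rfl⟩
    exact ⟨_, rfl⟩

theorem nonempty_fundamentalGroup_lensSpace7_mulEquiv {q : ℕ} (hq : q.Coprime 7)
    (x : LensSpace7 q) : Nonempty (FundamentalGroup (LensSpace7 q) x ≃* Multiplicative (ZMod 7)) := by
  have := simplyConnectedSpace_sphereC2
  obtain ⟨e, he⟩ := (isQuotientMap_lensProj q).surjective x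
  have equiv : FundamentalGroup (LensSpace7 q) x ≃* (LensDeck q)ᵐᵒᵖ :=
    (isQuotientCoveringMap_lensProj hq).fundamentalGroupEquiv ⟨e, he⟩
  exact ⟨equiv.trans (MulOpposite.opMulEquiv (M := LensDeck q)).symm⟩

theorem isOpenQuotientMap_lensProj {q : ℕ} (hq : q.Coprime 7) : IsOpenQuotientMap (lensProj q) where
  surjective := (isQuotientMap_lensProj q).surjective
  continuous := (isQuotientMap_lensProj q).continuous
  isOpenMap := (isQuotientCoveringMap_lensProj hq).isCoveringMap.isOpenMap

/-- The circle flow on `L(7,1)` whose time one map is the identity. -/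
noncomputable def lensFlow (t : ℝ) : LensSpace7 1 → LensSpace7 1 :=
  Quot.lift (fun x => lensProj 1 (rotate (t / 7) (t / 7) x)) fun x y h => by
    obtain ⟨n, rfl⟩ := (lensRel7_iff 1 x y).1 h
    refine lensProj_eq_iff.2 ⟨n, ?_⟩
    rw [deckMap, rotate_rotate, rotate_rotate, add_comm, add_comm (t / 7)]

theorem lensFlow_lensProj (t : ℝ) (x : SphereC2) :
    lensFlow t (lensProj 1 x) = lensProj 1 (rotate (t / 7) (t / 7) x) := rfl

theorem continuous_lensFlow : Continuous fun z : ℝ × LensSpace7 1 => lensFlow z.1 z.2 := by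
  have hquot := (IsOpenQuotientMap.id (X := ℝ)).prodMap (isOpenQuotientMap_lensProj (q := 1) (by simp))
  rw [hquot.isQuotientMap.continuous_iff]
  have hrotate : Continuous fun z : ℝ × SphereC2 => rotate (z.1 / 7) (z.1 / 7) z.2 :=
    continuous_rotate.comp (f := fun z : ℝ × SphereC2 => (z.1 / 7, z.1 / 7, z.2)) (by fun_prop)
  exact (isQuotientMap_lensProj 1).continuous.comp hrotate

theorem lensFlow_zero (y : LensSpace7 1) : lensFlow 0 y = y := by
  obtain ⟨x, rfl⟩ := (isQuotientMap_lensProj 1).surjective y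
  rw [lensFlow_lensProj, zero_div, rotate_zero]

theorem rotate_one_div_seven (x : SphereC2) : rotate (1 / 7) (1 / 7) x = deckMap 1 1 x := by
  simp [deckMap]

theorem lensFlow_one (y : LensSpace7 1) : lensFlow 1 y = y := by
  obtain ⟨x, rfl⟩ := (isQuotientMap_lensProj 1).surjective y
  rw [lensFlow_lensProj, rotate_one_div_seven, lensProj_deckMap]

theorem eq_zero_or_eq_one_of_lensFlow_eq {t : unitInterval} {y : LensSpace7 1}
    (h : lensFlow t y = y) : t = 0 ∨ t = 1 := by
  obtain ⟨x, rfl⟩ := (isQuotientMap_lensProj 1).surjective y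
  obtain ⟨n, hn⟩ := lensProj_eq_iff.1 h.symm
  have h0 := congrArg (fun y : SphereC2 => (y : EuclideanSpace ℂ (Fin 2)) 0) hn
  have h1 := congrArg (fun y : SphereC2 => (y : EuclideanSpace ℂ (Fin 2)) 1) hn
  simp only [rotate_fst, rotate_snd, deckMap_fst, deckMap_snd, one_mul] at h0 h1
  have hpow : expTurn (t / 7) = zeta7 ^ n := by
    rcases fst_ne_zero_or_snd_ne_zero x with hx | hx
    · exact mul_right_cancel₀ hx h0
    · exact mul_right_cancel₀ hx h1
  have hone : expTurn t = 1 := by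
    have h7 := congrArg (· ^ 7) hpow
    simp only [← pow_mul, mul_comm n 7, pow_mul zeta7, isPrimitiveRoot_zeta7.pow_eq_one,
      one_pow] at h7
    rw [← h7, expTurn, expTurn, ← Complex.exp_nat_mul]
    congr 1
    push_cast
    ring
  obtain ⟨m, hm⟩ := Complex.exp_eq_one_iff.1 hone
  have hm' : ((2 * Real.pi * t : ℝ) : ℂ) = ((2 * Real.pi * m : ℝ) : ℂ) := by
    apply mul_right_cancel₀ Complex.I_ne_zero
    rw [hm]
    push_cast
    ring
  have htm : (t : ℝ) = m := mul_left_cancel₀ (by positivity) (Complex.ofReal_injective hm')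
  have hm0 : (0 : ℝ) ≤ m := htm ▸ t.2.1
  have hm1 : (m : ℝ) ≤ 1 := htm ▸ t.2.2
  have : m = 0 ∨ m = 1 := by
    have h0 : 0 ≤ m := by exact_mod_cast hm0
    have h1 : m ≤ 1 := by exact_mod_cast hm1
    omega
  rcases this with rfl | rfl
  · exact Or.inl (Subtype.ext (by simpa using htm))
  · exact Or.inr (Subtype.ext (by simpa using htm))

theorem exists_lift_lensFlow_conj (h : LensSpace7 1 ≃ₜ LensSpace7 2) :
    ∃ H : C(unitInterval × SphereC2, SphereC2), (∀ x, H (0, x) = x) ∧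
      ∀ t x, lensProj 2 (H (t, x)) = h (lensFlow t (h.symm (lensProj 2 x))) := by
  have cov := (isQuotientCoveringMap_lensProj (q := 2) (by norm_num)).isCoveringMap
  have hproj : Continuous fun z : unitInterval × SphereC2 =>
      ((z.1 : ℝ), h.symm (lensProj 2 z.2)) :=
    (continuous_subtype_val.comp continuous_fst).prodMk
      (h.symm.continuous.comp (cov.continuous.comp continuous_snd))
  obtain ⟨Ψ, hΨ⟩ : ∃ Ψ : C(unitInterval × SphereC2, LensSpace7 2),
      ∀ t x, Ψ (t, x) = h (lensFlow t (h.symm (lensProj 2 x))) :=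
    ⟨⟨_, h.continuous.comp (continuous_lensFlow.comp hproj)⟩, fun _ _ => rfl⟩
  have Ψ_zero : ∀ x, Ψ (0, x) = lensProj 2 (ContinuousMap.id SphereC2 x) := fun x => by
    simp [hΨ, lensFlow_zero]
  refine ⟨cov.liftHomotopy Ψ (ContinuousMap.id _) Ψ_zero,
    cov.liftHomotopy_zero Ψ (.id _) Ψ_zero, fun t x => ?_⟩
  rw [← hΨ]
  exact congrFun (cov.liftHomotopy_lifts Ψ (.id _) Ψ_zero) (t, x)

/-- The deck transformation at time one is nontrivial, as the flow lines of the circle flow on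
`L(7,1)` are not null-homotopic. -/
theorem lift_one_ne {h : LensSpace7 1 ≃ₜ LensSpace7 2}
    {H : C(unitInterval × SphereC2, SphereC2)} (H_zero : ∀ x, H (0, x) = x)
    (H_lifts : ∀ t x, lensProj 2 (H (t, x)) = h (lensFlow t (h.symm (lensProj 2 x))))
    (x : SphereC2) : H (1, x) ≠ x := by
  intro hx
  have := simplyConnectedSpace_sphereC2
  have := locallyPathConnectedSpace_sphereC2
  have cov₁ := (isQuotientCoveringMap_lensProj (q := 1) (by norm_num)).isCoveringMap
  have cov₂ := (isQuotientCoveringMap_lensProj (q := 2) (by norm_num)).isCoveringMap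
  obtain ⟨y, hy⟩ := (isQuotientMap_lensProj 1).surjective (h.symm (lensProj 2 x))
  obtain ⟨F, ⟨hF0, hF⟩, -⟩ := cov₁.existsUnique_continuousMap_lifts
    (⟨fun x => h.symm (lensProj 2 x), h.symm.continuous.comp cov₂.continuous⟩ :
      C(SphereC2, LensSpace7 1)) x y hy
  have hF' : ∀ z, lensProj 1 (F z) = h.symm (lensProj 2 z) := congrFun hF
  have lifts : ∀ t : unitInterval, lensProj 1 (F (H (t, x))) =
      lensProj 1 (rotate (t / 7) (t / 7) y) := fun t => by
    rw [hF', H_lifts, ← lensFlow_lensProj, hy, h.symm_apply_apply]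
  have cont : Continuous fun t : unitInterval => rotate (t / 7) (t / 7) y :=
    continuous_rotate.comp (f := fun t : unitInterval => ((t : ℝ) / 7, (t : ℝ) / 7, y))
      (by fun_prop)
  have start : F (H (0, x)) = rotate (((0 : unitInterval) : ℝ) / 7) (((0 : unitInterval) : ℝ) / 7) y := by
    rw [H_zero, hF0, Set.Icc.coe_zero, zero_div, rotate_zero]
  have agree : F (H (1, x)) = rotate (((1 : unitInterval) : ℝ) / 7) (((1 : unitInterval) : ℝ) / 7) y :=
    congrFun (cov₁.eq_of_comp_eq (g₁ := fun t : unitInterval => F (H (t, x)))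
      (by fun_prop) cont (funext lifts) 0 start) 1
  rw [hx, hF0, Set.Icc.coe_one, rotate_one_div_seven] at agree
  have h01 : deckMap 1 0 y = deckMap 1 1 y := by rw [← agree]; simp [deckMap]
  exact absurd (deckMap_injective (by norm_num) h01) (by norm_num)

theorem lift_deckMap {h : LensSpace7 1 ≃ₜ LensSpace7 2}
    {H : C(unitInterval × SphereC2, SphereC2)} (H_zero : ∀ x, H (0, x) = x)
    (H_lifts : ∀ t x, lensProj 2 (H (t, x)) = h (lensFlow t (h.symm (lensProj 2 x))))
    (t : unitInterval) (x : SphereC2) : H (t, deckMap 2 1 x) = deckMap 2 1 (H (t, x)) := by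
  have cov := (isQuotientCoveringMap_lensProj (q := 2) (by norm_num)).isCoveringMap
  refine congrFun (cov.eq_of_comp_eq (g₁ := fun t => H (t, deckMap 2 1 x))
    (g₂ := fun t => deckMap 2 1 (H (t, x))) (by fun_prop)
    ((continuous_deckMap 2 1).comp (by fun_prop)) (funext fun s => ?_) 0 (by simp [H_zero])) t
  simp only [Function.comp_apply, H_lifts, lensProj_deckMap]

theorem exists_lift_one_eq_deckMap {h : LensSpace7 1 ≃ₜ LensSpace7 2}
    {H : C(unitInterval × SphereC2, SphereC2)}
    (H_lifts : ∀ t x, lensProj 2 (H (t, x)) = h (lensFlow t (h.symm (lensProj 2 x)))) :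
    ∃ c : Fin 7, ∀ x, H (1, x) = deckMap 2 c x := by
  have := simplyConnectedSpace_sphereC2
  have cov := (isQuotientCoveringMap_lensProj (q := 2) (by norm_num)).isCoveringMap
  have H_one : ∀ x, lensProj 2 (H (1, x)) = lensProj 2 x := fun x => by
    rw [H_lifts, Set.Icc.coe_one, lensFlow_one, h.apply_symm_apply]
  let x₀ : SphereC2 := sphereMk 1 0 (by simp)
  obtain ⟨n, hn⟩ := lensProj_eq_iff.1 (H_one x₀).symm
  refine ⟨⟨n % 7, Nat.mod_lt _ (by norm_num)⟩, fun x => ?_⟩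
  refine congrFun (cov.eq_of_comp_eq (g₁ := fun x => H (1, x)) (by fun_prop)
    (continuous_deckMap 2 (n % 7)) (funext fun y => ?_) x₀ (by rw [hn, deckMap_mod])) x
  simp only [Function.comp_apply, H_one, lensProj_deckMap]

theorem eq_deckMap_two_iff (k : ℕ) (x y : SphereC2) : y = deckMap 2 k x ↔
    (y : EuclideanSpace ℂ (Fin 2)) 0 =
      expTurn ((k : ℤ) / 7) * (x : EuclideanSpace ℂ (Fin 2)) 0 ∧
    (y : EuclideanSpace ℂ (Fin 2)) 1 =
      expTurn ((2 * (k : ℤ) : ℤ) / 7) * (x : EuclideanSpace ℂ (Fin 2)) 1 := by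
  have e0 := deckMap_fst 2 k x
  have e1 := deckMap_snd 2 k x
  rw [zeta7_pow] at e0 e1
  push_cast at e0 e1 ⊢
  rw [← e0, ← e1]
  exact ⟨fun h => h ▸ ⟨rfl, rfl⟩, fun h => sphere_ext h.1 h.2⟩

theorem isEmpty_lensSpace7_homeomorph : IsEmpty (LensSpace7 1 ≃ₜ LensSpace7 2) := by
  refine ⟨fun h => ?_⟩
  obtain ⟨H, H_zero, H_lifts⟩ := exists_lift_lensFlow_conj h
  obtain ⟨c, H_one⟩ := exists_lift_one_eq_deckMap H_lifts
  have c_ne : c ≠ 0 := by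
    rintro rfl
    exact lift_one_ne H_zero H_lifts (discPoint 0 0) (by simp [H_one, deckMap])
  refine no_avoiding_homotopy (fun t x => H (t, x)) H.continuous c c_ne H_zero
    (fun x => ((eq_deckMap_two_iff _ _ _).1 (H_one x)).1)
    (fun x => ((eq_deckMap_two_iff _ _ _).1 (H_one x)).2) ?_ ?_
  · intro t x y h0 h1
    have hy : y = deckMap 2 1 x := (eq_deckMap_two_iff 1 x y).2 (by simp [h0, h1, mul_comm])
    have := (eq_deckMap_two_iff 1 _ _).1
      ((congrArg (fun y => H (t, y)) hy).trans (lift_deckMap H_zero H_lifts t x))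
    simpa [mul_comm] using this
  · intro t x k hk0 hkc hk
    have hHk : H (t, x) = deckMap 2 k x := (eq_deckMap_two_iff k _ _).2 hk
    have hfix : lensFlow t (h.symm (lensProj 2 x)) = h.symm (lensProj 2 x) := by
      rw [h.eq_symm_apply, ← H_lifts, hHk, lensProj_deckMap]
    rcases eq_zero_or_eq_one_of_lensFlow_eq hfix with rfl | rfl
    · have h0 : deckMap 2 (0 : Fin 7) x = deckMap 2 k x := by rw [← hHk, H_zero]; simp [deckMap]
      have := deckMap_injective (by norm_num) h0
      rw [Nat.mod_eq_of_lt (Fin.is_lt _), Nat.mod_eq_of_lt k.is_lt] at this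
      exact hk0 (Fin.ext this.symm)
    · have := deckMap_injective (by norm_num) ((H_one x).symm.trans hHk)
      rw [Nat.mod_eq_of_lt c.is_lt, Nat.mod_eq_of_lt k.is_lt] at this
      exact hkc (Fin.ext this.symm)

/-- Alexander (1919): the lens spaces `L(7,1)` and `L(7,2)` have isomorphic fundamental
groups (both `ℤ/7`) but are not homeomorphic. -/
theorem lensSpaces_same_group_not_homeomorphic :
    (∀ x : LensSpace7 1, Nonempty (FundamentalGroup (LensSpace7 1) x ≃* Multiplicative (ZMod 7))) ∧
    (∀ x : LensSpace7 2, Nonempty (FundamentalGroup (LensSpace7 2) x ≃* Multiplicative (ZMod 7))) ∧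
    (∀ (x : LensSpace7 1) (y : LensSpace7 2),
      Nonempty (FundamentalGroup (LensSpace7 1) x ≃* FundamentalGroup (LensSpace7 2) y)) ∧
    IsEmpty (LensSpace7 1 ≃ₜ LensSpace7 2) := by
  have h₁ := fun x => nonempty_fundamentalGroup_lensSpace7_mulEquiv (q := 1) (by norm_num) x
  have h₂ := fun x => nonempty_fundamentalGroup_lensSpace7_mulEquiv (q := 2) (by norm_num) x
  exact ⟨h₁, h₂, fun x y => ⟨(h₁ x).some.trans (h₂ y).some.symm⟩, isEmpty_lensSpace7_homeomorph⟩
end
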